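/- arXiv:2007.02098 — 2 statements merged into one kernel-verified Lean document; each statement's English description precedes it below -/
import Mathlib

section
/- Let 0 < ν < 1 and x > 0. Define C_ν(φ) = (sin((1-ν)φ)/sin φ)·(sin(νφ)/sin φ)^{ν/(1-ν)} for 0 < φ < π. Then M_ν(x) = (1/π) · (x^{ν/(1-ν)}/(1-ν)) · ∫_0^π C_ν(φ) · exp(-C_ν(φ)·x^{1/(1-ν)}) dφ. -/
open scoped Real

/-- The Wright function `W_{λ,μ}(x) = ∑ xⁿ/(n!·Γ(λn+μ))` for real parameters and
real argument, with the convention `1/Γ(w) = 0` at poles of `Γ`. -/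
noncomputable def wright (l μ x : ℝ) : ℝ :=
  ∑' n : ℕ, x ^ n / ((n.factorial : ℝ) * Real.Gamma (l * n + μ))

/-- The Mainardi function `M_ν(x) := W_{-ν,1-ν}(-x)`. -/
noncomputable def mainardiM (ν x : ℝ) : ℝ := wright (-ν) (1 - ν) (-x)


open Filter Topology Set MeasureTheory

/-- The integrand `exp(σ - xσ^ν)σ^(ν-1) dσ` of the Hankel representation of `M_ν(x)`, in the
logarithmic coordinate `σ = e^w`, in which it is entire. -/
noncomputable def hankelIntegrand (ν x : ℝ) (w : ℂ) : ℂ :=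
  Complex.exp (Complex.exp w - x * Complex.exp (ν * w) + ν * w)

theorem exists_primitive_hankelIntegrand (ν x : ℝ) :
    ∃ G : ℂ → ℂ, ∀ w, HasDerivAt G (hankelIntegrand ν x w) w := by
  have hd : Differentiable ℂ (hankelIntegrand ν x) := by
    unfold hankelIntegrand
    fun_prop
  obtain ⟨G, hG⟩ := hd.isExactOn_univ
  exact ⟨G, fun w => hG w (mem_univ w)⟩

theorem exp_ofReal_add_mul_I (a b : ℝ) :
    Complex.exp (a + b * Complex.I) =
      ((Real.exp a * Real.cos b : ℝ) : ℂ) + ((Real.exp a * Real.sin b : ℝ) : ℂ) * Complex.I := by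
  rw [Complex.exp_add, Complex.exp_mul_I]
  push_cast
  ring

theorem hankelIntegrand_eq (ν x u ψ : ℝ) :
    hankelIntegrand ν x (u + ψ * Complex.I) =
      Complex.exp
        (((Real.exp u * Real.cos ψ - x * (Real.exp (ν * u) * Real.cos (ν * ψ)) + ν * u : ℝ) : ℂ) +
          ((Real.exp u * Real.sin ψ - x * (Real.exp (ν * u) * Real.sin (ν * ψ)) + ν * ψ : ℝ) : ℂ) *
            Complex.I) := by
  have h : (ν : ℂ) * (u + ψ * Complex.I) = ((ν * u : ℝ) : ℂ) + ((ν * ψ : ℝ) : ℂ) * Complex.I := by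
    push_cast
    ring
  rw [hankelIntegrand, h, exp_ofReal_add_mul_I, exp_ofReal_add_mul_I]
  congr 1
  push_cast
  ring

theorem norm_hankelIntegrand_le {ν x : ℝ} (hx : 0 < x) (u ψ : ℝ) :
    ‖hankelIntegrand ν x (u + ψ * Complex.I)‖ ≤
      Real.exp (Real.exp u * Real.cos ψ + x * Real.exp (ν * u) + ν * u) := by
  rw [hankelIntegrand_eq, Complex.norm_exp]
  apply Real.exp_le_exp.2
  have h := mul_le_mul_of_nonneg_left (Real.neg_one_le_cos (ν * ψ))
    (mul_pos hx (Real.exp_pos (ν * u))).le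
  simp only [Complex.add_re, Complex.ofReal_re, Complex.re_ofReal_mul, Complex.I_re]
  linarith

theorem norm_vertical_sub_le {ν x : ℝ} {G : ℂ → ℂ}
    (hG : ∀ w, HasDerivAt G (hankelIntegrand ν x w) w) {u M a b : ℝ} (hab : a ≤ b)
    (hM : ∀ ψ ∈ Icc a b, ‖hankelIntegrand ν x (u + ψ * Complex.I)‖ ≤ M) :
    ‖G (u + b * Complex.I) - G (u + a * Complex.I)‖ ≤ M * (b - a) := by
  have hd : ∀ ψ : ℝ, HasDerivAt (fun ψ : ℝ => G (u + ψ * Complex.I))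
      (hankelIntegrand ν x (u + ψ * Complex.I) * Complex.I) ψ := by
    intro ψ
    have h1 : HasDerivAt (fun ψ : ℝ => (u : ℂ) + ψ * Complex.I) Complex.I ψ := by
      simpa using ((Complex.ofRealCLM.hasDerivAt (x := ψ)).mul_const Complex.I).const_add (u : ℂ)
    exact (hG _).comp ψ h1
  have h := (convex_Icc a b).norm_image_sub_le_of_norm_hasDerivWithin_le
    (fun ψ _ => (hd ψ).hasDerivWithinAt) (C := M)
    (fun ψ hψ => by simpa using hM ψ hψ) (left_mem_Icc.2 hab) (right_mem_Icc.2 hab)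
  rwa [Real.norm_eq_abs, abs_of_nonneg (sub_nonneg.2 hab)] at h

theorem im_primitive_ofReal_eq {ν x : ℝ} {G : ℂ → ℂ}
    (hG : ∀ w, HasDerivAt G (hankelIntegrand ν x w) w) (u v : ℝ) :
    (G u).im = (G v).im := by
  have hd : ∀ t : ℝ, HasDerivAt (fun t : ℝ => (G t).im) 0 t := by
    intro t
    have h := Complex.imCLM.hasFDerivAt.comp_hasDerivAt t (hG t).comp_ofReal
    have h0 : (hankelIntegrand ν x t).im = 0 := by
      have := hankelIntegrand_eq ν x t 0
      rw [Complex.ofReal_zero, zero_mul, add_zero] at this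
      simp [this, Complex.exp_im]
    rw [← h0]
    exact h
  exact is_const_of_deriv_eq_zero (fun t => (hd t).differentiableAt) (fun t => (hd t).deriv) u v

theorem exists_mul_rpow_le {ν : ℝ} (hν0 : 0 < ν) (hν1 : ν < 1) {x : ℝ} (hx : 0 < x) :
    ∃ K : ℝ, ∀ t : ℝ, 0 < t → x * t ^ ν ≤ t / 4 + K := by
  have hs : 0 < 1 - ν := by linarith
  refine ⟨x * ((4 * x) ^ (1 / (1 - ν))) ^ ν, fun t ht => ?_⟩
  rcases le_total t ((4 * x) ^ (1 / (1 - ν))) with h | h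
  · have := mul_le_mul_of_nonneg_left (Real.rpow_le_rpow ht.le h hν0.le) hx.le
    linarith
  · have h1 : 4 * x ≤ t ^ (1 - ν) := by
      have := Real.rpow_le_rpow (by positivity) h hs.le
      rwa [← Real.rpow_mul (by positivity), one_div_mul_cancel hs.ne', Real.rpow_one] at this
    have h2 : t ^ (1 - ν) * t ^ ν = t := by
      rw [← Real.rpow_add ht]; simp
    have h3 := mul_le_mul_of_nonneg_right h1 (Real.rpow_nonneg ht.le ν)
    have h4 : 0 ≤ x * ((4 * x) ^ (1 / (1 - ν))) ^ ν := by positivity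
    linarith

theorem integrableOn_exp_mul_rpow_mul_exp {ν : ℝ} (hν0 : 0 < ν) (hν1 : ν < 1) {x : ℝ}
    (hx : 0 < x) :
    IntegrableOn (fun t : ℝ => Real.exp (-t) * t ^ (ν - 1) * Real.exp (x * t ^ ν)) (Ioi 0) := by
  obtain ⟨K, hK⟩ := exists_mul_rpow_le hν0 hν1 hx
  have h := (integrableOn_rpow_mul_exp_neg_mul_rpow (p := 1) (s := ν - 1) (b := 1 / 2)
    (by linarith) one_pos (by norm_num)).const_mul (Real.exp K)
  refine Integrable.mono' h ?_ ?_
  · apply ContinuousOn.aestronglyMeasurable _ measurableSet_Ioi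
    refine ContinuousOn.mul (ContinuousOn.mul (by fun_prop) ?_) (ContinuousOn.rexp ?_)
    · exact fun t ht => (Real.continuousAt_rpow_const _ _ (Or.inl (ne_of_gt ht))).continuousWithinAt
    · exact fun t ht => ((Real.continuousAt_rpow_const _ _
        (Or.inl (ne_of_gt ht))).const_mul x).continuousWithinAt
  · filter_upwards [ae_restrict_mem measurableSet_Ioi] with t ht
    have ht : 0 < t := ht
    have hp := Real.rpow_nonneg ht.le (ν - 1)
    rw [Real.norm_of_nonneg (by positivity), Real.rpow_one]
    calc Real.exp (-t) * t ^ (ν - 1) * Real.exp (x * t ^ ν)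
        = t ^ (ν - 1) * Real.exp (-t + x * t ^ ν) := by rw [Real.exp_add]; ring
      _ ≤ t ^ (ν - 1) * Real.exp (K + -(1 / 2) * t) := by
          have := hK t ht
          gcongr ?_ * Real.exp ?_
          linarith
      _ = _ := by rw [Real.exp_add]; ring

theorem sin_mul_Gamma_eq {s : ℝ} (hs : 0 < s) :
    Real.sin (π * s) * Real.Gamma s = π / Real.Gamma (1 - s) := by
  have h := Real.Gamma_mul_Gamma_one_sub s
  have hG := (Real.Gamma_pos_of_pos hs).ne'
  by_cases h0 : Real.sin (π * s) = 0
  · rw [h0, div_zero, mul_eq_zero, or_iff_right hG] at h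
    simp [h0, h]
  · have h1 : Real.Gamma (1 - s) ≠ 0 := by
      intro h1
      rw [h1, mul_zero, eq_comm, div_eq_zero_iff] at h
      exact h.elim Real.pi_ne_zero h0
    rw [eq_div_iff h0] at h
    rw [eq_div_iff h1]
    linarith

/-- The imaginary part of the Hankel integrand on the upper side of the branch cut, at
`σ = -t`. -/
noncomputable def cutIntegrand (ν x t : ℝ) : ℝ :=
  Real.exp (-t) * t ^ (ν - 1) *
    (Complex.exp (-x * (t ^ ν : ℝ) * Complex.exp ((π * ν : ℝ) * Complex.I)) *
      Complex.exp ((π * ν : ℝ) * Complex.I)).im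

theorem rpow_mul_add_one_sub_one {t : ℝ} (ht : 0 < t) (ν : ℝ) (n : ℕ) :
    t ^ (ν * (n + 1) - 1) = t ^ (ν - 1) * (t ^ ν) ^ n := by
  rw [← Real.rpow_mul_natCast ht.le, ← Real.rpow_add ht]
  congr 1
  ring

theorem hasSum_cutIntegrand (ν x : ℝ) {t : ℝ} (ht : 0 < t) :
    HasSum (fun n : ℕ => (-x) ^ n / n.factorial * Real.sin (π * (ν * (n + 1))) *
      (Real.exp (-t) * t ^ (ν * (n + 1) - 1))) (cutIntegrand ν x t) := by
  have h := NormedSpace.expSeries_div_hasSum_exp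
    (-x * (t ^ ν : ℝ) * Complex.exp ((π * ν : ℝ) * Complex.I) : ℂ)
  rw [← Complex.exp_eq_exp_ℂ] at h
  have h2 := (Complex.hasSum_im (h.mul_right
    (Complex.exp ((π * ν : ℝ) * Complex.I)))).mul_left (Real.exp (-t) * t ^ (ν - 1))
  unfold cutIntegrand
  convert! h2 using 1
  funext n
  have hE : (-x * (t ^ ν : ℝ) * Complex.exp ((π * ν : ℝ) * Complex.I) : ℂ) ^ n / n.factorial *
      Complex.exp ((π * ν : ℝ) * Complex.I) =
      (((-x) ^ n * (t ^ ν) ^ n / n.factorial : ℝ) : ℂ) *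
        Complex.exp ((π * (ν * (n + 1)) : ℝ) * Complex.I) := by
    have : Complex.exp ((π * (ν * (n + 1)) : ℝ) * Complex.I) =
        Complex.exp ((π * ν : ℝ) * Complex.I) ^ n * Complex.exp ((π * ν : ℝ) * Complex.I) := by
      rw [← Complex.exp_nat_mul, ← Complex.exp_add]
      congr 1
      push_cast
      ring
    rw [this]
    push_cast
    ring
  rw [hE, Complex.im_ofReal_mul, Complex.exp_ofReal_mul_I_im, rpow_mul_add_one_sub_one ht]
  ring

theorem pi_mul_mainardiM_eq_integral {ν : ℝ} (hν0 : 0 < ν) (hν1 : ν < 1) {x : ℝ} (hx : 0 < x) :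
    π * mainardiM ν x = ∫ t in Ioi (0 : ℝ), cutIntegrand ν x t := by
  have key := hasSum_integral_of_dominated_convergence (μ := volume.restrict (Ioi (0 : ℝ)))
    (F := fun (n : ℕ) t => (-x) ^ n / n.factorial * Real.sin (π * (ν * (n + 1))) *
      (Real.exp (-t) * t ^ (ν * (n + 1) - 1))) (f := cutIntegrand ν x)
    (fun n t => Real.exp (-t) * t ^ (ν - 1) * ((x * t ^ ν) ^ n / n.factorial)) ?_ ?_ ?_ ?_ ?_
  · have hterm : ∀ n : ℕ, ∫ t in Ioi (0 : ℝ), (-x) ^ n / n.factorial *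
        Real.sin (π * (ν * (n + 1))) * (Real.exp (-t) * t ^ (ν * (n + 1) - 1)) =
        π * ((-x) ^ n / (n.factorial * Real.Gamma (-ν * n + (1 - ν)))) := by
      intro n
      have hs : 0 < ν * ((n : ℝ) + 1) := by positivity
      rw [integral_const_mul, ← Real.Gamma_eq_integral hs, mul_assoc, sin_mul_Gamma_eq hs,
        show -ν * n + (1 - ν) = 1 - ν * ((n : ℝ) + 1) by ring]
      field_simp
    simp only [hterm] at key
    rw [← key.tsum_eq, tsum_mul_left]
    rfl
  · intro n
    have hs : 0 < ν * ((n : ℝ) + 1) := by positivity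
    exact ((Real.GammaIntegral_convergent hs).const_mul _).aestronglyMeasurable
  · intro n
    filter_upwards [ae_restrict_mem measurableSet_Ioi] with t ht
    have ht : 0 < t := ht
    have hp := Real.rpow_nonneg ht.le (ν - 1)
    have hq := Real.rpow_nonneg ht.le ν
    rw [rpow_mul_add_one_sub_one ht, norm_mul, norm_mul, norm_div, norm_pow, norm_neg,
      Real.norm_of_nonneg hx.le,
      Real.norm_natCast, Real.norm_eq_abs (Real.sin _),
      Real.norm_of_nonneg (by positivity : 0 ≤ Real.exp (-t) * (t ^ (ν - 1) * (t ^ ν) ^ n))]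
    calc x ^ n / n.factorial * |Real.sin (π * (ν * (n + 1)))| *
          (Real.exp (-t) * (t ^ (ν - 1) * (t ^ ν) ^ n))
        ≤ x ^ n / n.factorial * 1 * (Real.exp (-t) * (t ^ (ν - 1) * (t ^ ν) ^ n)) := by
          gcongr
          exact Real.abs_sin_le_one _
      _ = _ := by rw [mul_pow]; ring
  · filter_upwards with t
    exact (Real.summable_pow_div_factorial _).mul_left _
  · simp_rw [tsum_mul_left]
    refine (integrableOn_exp_mul_rpow_mul_exp hν0 hν1 hx).congr (ae_of_all _ fun t => ?_)
    simp only [Real.exp_eq_exp_ℝ, NormedSpace.exp_eq_tsum_div]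
  · filter_upwards [ae_restrict_mem measurableSet_Ioi] with t ht
    exact hasSum_cutIntegrand ν x ht

theorem integrableOn_cutIntegrand {ν : ℝ} (hν0 : 0 < ν) (hν1 : ν < 1) {x : ℝ} (hx : 0 < x) :
    IntegrableOn (cutIntegrand ν x) (Ioi 0) := by
  refine Integrable.mono' (integrableOn_exp_mul_rpow_mul_exp hν0 hν1 hx) ?_ ?_
  · have hm : Measurable (cutIntegrand ν x) := by
      unfold cutIntegrand
      fun_prop
    exact hm.aestronglyMeasurable
  · filter_upwards [ae_restrict_mem measurableSet_Ioi] with t ht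
    have hq := Real.rpow_nonneg (le_of_lt ht) ν
    rw [cutIntegrand, norm_mul,
      Real.norm_of_nonneg (mul_nonneg (Real.exp_pos _).le (Real.rpow_nonneg (le_of_lt ht) _))]
    refine mul_le_mul_of_nonneg_left ((Complex.abs_im_le_norm _).trans ?_)
      (mul_nonneg (Real.exp_pos _).le (Real.rpow_nonneg (le_of_lt ht) _))
    rw [norm_mul, Complex.norm_exp_ofReal_mul_I, mul_one]
    refine (Complex.norm_exp_le_exp_norm _).trans (Real.exp_le_exp.2 ?_)
    rw [norm_mul, Complex.norm_exp_ofReal_mul_I, mul_one, norm_mul, norm_neg, Complex.norm_real,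
      Complex.norm_real, Real.norm_of_nonneg hx.le, Real.norm_of_nonneg hq]

theorem hasDerivAt_im_primitive_log {ν x : ℝ} {G : ℂ → ℂ}
    (hG : ∀ w, HasDerivAt G (hankelIntegrand ν x w) w) {t : ℝ} (ht : 0 < t) :
    HasDerivAt (fun t : ℝ => (G ((Real.log t : ℝ) + (π : ℝ) * Complex.I)).im)
      (cutIntegrand ν x t) t := by
  have h1 : HasDerivAt (fun t : ℝ => ((Real.log t : ℝ) : ℂ) + (π : ℝ) * Complex.I)
      ((t⁻¹ : ℝ) : ℂ) t := (Real.hasDerivAt_log ht.ne').ofReal_comp.add_const _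
  have h2 := Complex.imCLM.hasFDerivAt.comp_hasDerivAt t ((hG _).comp t h1)
  refine h2.congr_deriv ?_
  have hν : Complex.exp (ν * ((Real.log t : ℝ) + (π : ℝ) * Complex.I)) =
      (t ^ ν : ℝ) * Complex.exp ((π * ν : ℝ) * Complex.I) := by
    rw [Real.rpow_def_of_pos ht, Complex.ofReal_exp, ← Complex.exp_add]
    congr 1
    push_cast
    ring
  have h1 : Complex.exp ((Real.log t : ℝ) + (π : ℝ) * Complex.I) = ((-t : ℝ) : ℂ) := by
    rw [exp_ofReal_add_mul_I, Real.exp_log ht]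
    simp
  have hpow : t ^ (ν - 1) = t ^ ν * t⁻¹ := by
    rw [Real.rpow_sub_one ht.ne', div_eq_mul_inv]
  rw [Complex.imCLM_apply, hankelIntegrand, Complex.exp_add, hν, sub_eq_add_neg, Complex.exp_add,
    h1, ← Complex.ofReal_exp, cutIntegrand, ← Complex.im_ofReal_mul, hpow]
  congr 1
  push_cast
  ring_nf

theorem tendsto_im_primitive_log_zero {ν : ℝ} (hν0 : 0 < ν) {x : ℝ} (hx : 0 < x) {G : ℂ → ℂ}
    (hG : ∀ w, HasDerivAt G (hankelIntegrand ν x w) w) :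
    Tendsto (fun t : ℝ => (G ((Real.log t : ℝ) + (π : ℝ) * Complex.I)).im) (𝓝[>] 0)
      (𝓝 (G 0).im) := by
  rw [← tendsto_sub_nhds_zero_iff]
  have hb : Tendsto (fun t : ℝ => Real.exp (t + x * t ^ ν) * t ^ ν * π) (𝓝[>] 0) (𝓝 0) := by
    have hc : ContinuousAt (fun t : ℝ => Real.exp (t + x * t ^ ν) * t ^ ν * π) 0 := by
      have := Real.continuousAt_rpow_const 0 ν (Or.inr hν0.le)
      fun_prop
    have := hc.tendsto.mono_left (nhdsWithin_le_nhds (s := Ioi (0 : ℝ)))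
    simpa [Real.zero_rpow hν0.ne'] using this
  refine squeeze_zero_norm' ?_ hb
  filter_upwards [self_mem_nhdsWithin] with t ht
  have ht : 0 < t := ht
  have h := norm_vertical_sub_le hG (u := Real.log t) (a := 0) (b := π)
    (M := Real.exp (t + x * t ^ ν) * t ^ ν) Real.pi_pos.le (fun ψ _ => by
      refine (norm_hankelIntegrand_le hx _ ψ).trans ?_
      rw [Real.exp_log ht, mul_comm ν, ← Real.rpow_def_of_pos ht, Real.exp_add,
        ← Real.rpow_def_of_pos ht]
      gcongr
      nlinarith [Real.cos_le_one ψ])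
  have hre := im_primitive_ofReal_eq hG 0 (Real.log t)
  rw [Complex.ofReal_zero] at hre
  rw [hre, ← Complex.sub_im]
  refine (Complex.abs_im_le_norm _).trans ?_
  simpa using h

theorem tendsto_im_primitive_atTop {ν : ℝ} (hν0 : 0 < ν) (hν1 : ν < 1) {x : ℝ} (hx : 0 < x)
    {G : ℂ → ℂ} (hG : ∀ w, HasDerivAt G (hankelIntegrand ν x w) w) :
    Tendsto (fun u : ℝ => (G (u + (π : ℝ) * Complex.I)).im) atTop
      (𝓝 ((G 0).im + π * mainardiM ν x)) := by
  set f : ℝ → ℝ := fun t => (G ((Real.log t : ℝ) + (π : ℝ) * Complex.I)).im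
  have hint := integrableOn_cutIntegrand hν0 hν1 hx
  have hlim := tendsto_limUnder_of_hasDerivAt_of_integrableOn_Ioi
    (fun t (ht : t ∈ Ioi (0 : ℝ)) => hasDerivAt_im_primitive_log hG ht) hint
  have h0 := tendsto_im_primitive_log_zero hν0 hx hG
  have hupd : ∀ t : ℝ, 0 < t → Function.update f 0 (G 0).im =ᶠ[𝓝 t] f := fun t ht => by
    filter_upwards [isOpen_ne.mem_nhds ht.ne'] with s hs
    exact Function.update_of_ne hs _ _
  have h := integral_Ioi_of_hasDerivAt_of_tendsto (f := Function.update f 0 (G 0).im) (a := 0)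
    (continuousWithinAt_update_same.2 (h0.mono_left (nhdsWithin_mono _ fun t ht =>
      lt_of_le_of_ne ht.1 (Ne.symm ht.2))))
    (fun t ht => (hasDerivAt_im_primitive_log hG ht).congr_of_eventuallyEq (hupd t ht)) hint
    (hlim.congr' (by
      filter_upwards [eventually_ne_atTop 0] with s hs
      exact (Function.update_of_ne hs _ f).symm))
  rw [← pi_mul_mainardiM_eq_integral hν0 hν1 hx, Function.update_self] at h
  rw [h, add_sub_cancel]
  refine (hlim.comp Real.tendsto_exp_atTop).congr fun u => ?_
  simp

/-- The real part, at argument `φ`, of the curve along which the phase of the Hankel integrand is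
real, in logarithmic coordinates. -/
noncomputable def curveLog (ν x φ : ℝ) : ℝ :=
  Real.log (x * (Real.sin (ν * φ) / Real.sin φ)) / (1 - ν)

theorem sin_mul_pos {ν φ : ℝ} (hν0 : 0 < ν) (hν1 : ν < 1) (hφ : φ ∈ Ioo 0 π) :
    0 < Real.sin (ν * φ) :=
  Real.sin_pos_of_pos_of_lt_pi (mul_pos hν0 hφ.1) (by nlinarith [hφ.1, hφ.2])

theorem hasDerivAt_curveLog {ν x φ : ℝ} (hν0 : 0 < ν) (hν1 : ν < 1) (hx : 0 < x)
    (hφ : φ ∈ Ioo 0 π) :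
    HasDerivAt (curveLog ν x)
      ((ν * Real.cos (ν * φ) / Real.sin (ν * φ) - Real.cos φ / Real.sin φ) / (1 - ν)) φ := by
  have hA := sin_mul_pos hν0 hν1 hφ
  have hS := Real.sin_pos_of_mem_Ioo hφ
  have h1 : HasDerivAt (fun φ => Real.sin (ν * φ)) (Real.cos (ν * φ) * ν) φ := by
    simpa using ((hasDerivAt_id φ).const_mul ν).sin
  have h2 := (((h1.div (Real.hasDerivAt_sin φ) hS.ne').const_mul x).log
    (by simp only [Pi.div_apply]; positivity)).div_const (1 - ν)
  refine h2.congr_deriv ?_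
  simp only [Pi.div_apply]
  have : 1 - ν ≠ 0 := by linarith
  field_simp

theorem exp_mul_curveLog {ν x φ : ℝ} (hν0 : 0 < ν) (hν1 : ν < 1) (hx : 0 < x)
    (hφ : φ ∈ Ioo 0 π) (s : ℝ) :
    Real.exp (s * curveLog ν x φ) =
      x ^ (s / (1 - ν)) * (Real.sin (ν * φ) / Real.sin φ) ^ (s / (1 - ν)) := by
  have hA := sin_mul_pos hν0 hν1 hφ
  have hS := Real.sin_pos_of_mem_Ioo hφ
  rw [← Real.mul_rpow hx.le (by positivity), Real.rpow_def_of_pos (by positivity), curveLog]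
  congr 1
  ring

/-- Kanter's function `C_ν(φ)`. -/
noncomputable def kanterC (ν φ : ℝ) : ℝ :=
  (Real.sin ((1 - ν) * φ) / Real.sin φ) * (Real.sin (ν * φ) / Real.sin φ) ^ (ν / (1 - ν))

theorem hasDerivAt_im_primitive_curve {ν x φ : ℝ} (hν0 : 0 < ν) (hν1 : ν < 1) (hx : 0 < x)
    {G : ℂ → ℂ} (hG : ∀ w, HasDerivAt G (hankelIntegrand ν x w) w) (hφ : φ ∈ Ioo 0 π) :
    HasDerivAt (fun φ : ℝ => (G ((curveLog ν x φ : ℝ) + φ * Complex.I)).im)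
      (x ^ (ν / (1 - ν)) / (1 - ν) *
        (kanterC ν φ * Real.exp (-(kanterC ν φ) * x ^ (1 / (1 - ν))))) φ := by
  have hA := sin_mul_pos hν0 hν1 hφ
  have hS := Real.sin_pos_of_mem_Ioo hφ
  have hne : 1 - ν ≠ 0 := by linarith
  have h1 := (hasDerivAt_curveLog hν0 hν1 hx hφ).ofReal_comp.add
    ((Complex.ofRealCLM.hasDerivAt (x := φ)).mul_const Complex.I)
  have h2 := Complex.imCLM.hasFDerivAt.comp_hasDerivAt φ ((hG _).comp φ h1)
  refine h2.congr_deriv ?_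
  set u := curveLog ν x φ with hu
  have hsin : Real.sin ((1 - ν) * φ) =
      Real.sin φ * Real.cos (ν * φ) - Real.cos φ * Real.sin (ν * φ) := by
    rw [← Real.sin_sub]; ring_nf
  have heν := exp_mul_curveLog hν0 hν1 hx hφ ν
  have he1 := exp_mul_curveLog hν0 hν1 hx hφ 1
  rw [one_mul] at he1
  rw [← hu] at heν he1
  have hx1 : x ^ (1 / (1 - ν)) = x ^ (ν / (1 - ν)) * x := by
    rw [← Real.rpow_add_one hx.ne']; congr 1; field_simp; ring
  have hy1 : (Real.sin (ν * φ) / Real.sin φ) ^ (1 / (1 - ν)) =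
      (Real.sin (ν * φ) / Real.sin φ) ^ (ν / (1 - ν)) * (Real.sin (ν * φ) / Real.sin φ) := by
    rw [← Real.rpow_add_one (by positivity)]; congr 1; field_simp; ring
  have hre : Real.exp u * Real.cos φ - x * (Real.exp (ν * u) * Real.cos (ν * φ)) =
      -(kanterC ν φ) * x ^ (1 / (1 - ν)) := by
    rw [he1, heν, kanterC, hsin, hx1, hy1]
    field_simp
    ring
  have him : Real.exp u * Real.sin φ - x * (Real.exp (ν * u) * Real.sin (ν * φ)) = 0 := by
    rw [he1, heν, hx1, hy1]
    field_simp
    ring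
  simp only [Pi.add_apply, Complex.ofRealCLM_apply, Complex.imCLM_apply, ← hu]
  rw [hankelIntegrand_eq, hre, him, zero_add, exp_ofReal_add_mul_I, Real.exp_add, heν]
  simp only [Complex.mul_im, Complex.add_re, Complex.add_im, Complex.ofReal_re, Complex.ofReal_im,
    Complex.mul_re, Complex.I_re, Complex.I_im, Complex.ofReal_one, Complex.one_re, Complex.one_im]
  rw [kanterC, hsin]
  field_simp
  ring

theorem tendsto_sin_mul_div_sin (ν : ℝ) :
    Tendsto (fun φ : ℝ => Real.sin (ν * φ) / Real.sin φ) (𝓝[>] 0) (𝓝 ν) := by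
  have hs : ∀ a : ℝ, Tendsto (fun φ : ℝ => Real.sin (a * φ) / φ) (𝓝[>] 0) (𝓝 a) := fun a => by
    have h1 : HasDerivAt (fun φ => Real.sin (a * φ)) a 0 := by
      simpa using ((hasDerivAt_id (0 : ℝ)).const_mul a).sin
    refine (h1.tendsto_slope_zero_right).congr fun φ => ?_
    simp [div_eq_inv_mul]
  have h := (hs ν).div (hs 1) one_ne_zero
  rw [div_one] at h
  refine h.congr' ?_
  filter_upwards [self_mem_nhdsWithin] with φ hφ
  have hφ : (0 : ℝ) < φ := hφ
  simp only [one_mul]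
  exact div_div_div_cancel_right₀ hφ.ne' _ _

theorem tendsto_im_primitive_curve_zero {ν x : ℝ} (hν0 : 0 < ν) (hx : 0 < x)
    {G : ℂ → ℂ} (hG : ∀ w, HasDerivAt G (hankelIntegrand ν x w) w) :
    Tendsto (fun φ : ℝ => (G ((curveLog ν x φ : ℝ) + φ * Complex.I)).im) (𝓝[>] 0)
      (𝓝 (G 0).im) := by
  have hu : Tendsto (curveLog ν x) (𝓝[>] 0) (𝓝 (Real.log (x * ν) / (1 - ν))) :=
    (((tendsto_sin_mul_div_sin ν).const_mul x).log (by positivity)).div_const _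
  have hφ : Tendsto (fun φ : ℝ => (φ : ℂ) * Complex.I) (𝓝[>] 0) (𝓝 0) := by
    have : Continuous fun φ : ℝ => (φ : ℂ) * Complex.I := by fun_prop
    simpa using (this.tendsto 0).mono_left (nhdsWithin_le_nhds (s := Ioi (0 : ℝ)))
  have hw := ((Complex.continuous_ofReal.tendsto _).comp hu).add hφ
  rw [add_zero] at hw
  have h := (Complex.continuous_im.tendsto _).comp ((hG _).continuousAt.tendsto.comp hw)
  rw [im_primitive_ofReal_eq hG _ 0, Complex.ofReal_zero] at h
  exact h

theorem tendsto_curveLog_pi {ν x : ℝ} (hν0 : 0 < ν) (hν1 : ν < 1) (hx : 0 < x) :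
    Tendsto (curveLog ν x) (𝓝[<] π) atTop := by
  have hS : Tendsto (fun φ => (Real.sin φ)⁻¹) (𝓝[<] π) atTop := by
    refine Tendsto.inv_tendsto_nhdsGT_zero (tendsto_nhdsWithin_iff.2 ⟨?_, ?_⟩)
    · simpa using (Real.continuous_sin.tendsto π).mono_left (nhdsWithin_le_nhds (s := Iio π))
    · filter_upwards [Ioo_mem_nhdsLT Real.pi_pos] with φ hφ
      exact Real.sin_pos_of_mem_Ioo hφ
  have hA : Tendsto (fun φ => Real.sin (ν * φ)) (𝓝[<] π) (𝓝 (Real.sin (ν * π))) := by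
    have : Continuous fun φ => Real.sin (ν * φ) := by fun_prop
    exact (this.tendsto π).mono_left nhdsWithin_le_nhds
  have hpos : 0 < Real.sin (ν * π) :=
    Real.sin_pos_of_pos_of_lt_pi (mul_pos hν0 Real.pi_pos) (by nlinarith [Real.pi_pos])
  have h := (hA.pos_mul_atTop hpos hS).const_mul_atTop hx
  exact (Real.tendsto_log_atTop.comp h).atTop_div_const (by linarith)

theorem tendsto_im_primitive_curve_pi {ν x : ℝ} (hν0 : 0 < ν) (hν1 : ν < 1) (hx : 0 < x)
    {G : ℂ → ℂ} (hG : ∀ w, HasDerivAt G (hankelIntegrand ν x w) w) :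
    Tendsto (fun φ : ℝ => (G ((curveLog ν x φ : ℝ) + φ * Complex.I)).im) (𝓝[<] π)
      (𝓝 ((G 0).im + π * mainardiM ν x)) := by
  obtain ⟨K, hK⟩ := exists_mul_rpow_le hν0 hν1 hx
  have h1 := (tendsto_im_primitive_atTop hν0 hν1 hx hG).comp (tendsto_curveLog_pi hν0 hν1 hx)
  have h2 : Tendsto (fun φ : ℝ => (G ((curveLog ν x φ : ℝ) + (π : ℝ) * Complex.I)).im -
      (G ((curveLog ν x φ : ℝ) + φ * Complex.I)).im) (𝓝[<] π) (𝓝 0) := by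
    have hb : Tendsto (fun φ => Real.exp (4 + K) * (π - φ)) (𝓝[<] π) (𝓝 0) := by
      have : Continuous fun φ => Real.exp (4 + K) * (π - φ) := by fun_prop
      simpa using (this.tendsto π).mono_left (nhdsWithin_le_nhds (s := Iio π))
    refine squeeze_zero_norm' ?_ hb
    have hπ := Real.pi_pos
    filter_upwards [Ioo_mem_nhdsLT (show π - π / 3 < π by linarith),
      (tendsto_curveLog_pi hν0 hν1 hx).eventually_ge_atTop 0] with φ hφ hu
    rw [← Complex.sub_im]
    refine (Complex.abs_im_le_norm _).trans
      (norm_vertical_sub_le hG hφ.2.le fun ψ hψ => (norm_hankelIntegrand_le hx _ ψ).trans ?_)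
    apply Real.exp_le_exp.2
    set u := curveLog ν x φ
    have hcos : Real.cos ψ ≤ -(1 / 2) := by
      rw [← Real.cos_pi_div_three, ← Real.cos_pi_sub]
      exact Real.cos_le_cos_of_nonneg_of_le_pi (by linarith) hψ.2 (by linarith [hφ.1, hψ.1])
    have h3 := hK (Real.exp u) (Real.exp_pos u)
    rw [← Real.exp_mul, mul_comm u] at h3
    have h4 := mul_le_mul_of_nonneg_left hcos (Real.exp_pos u).le
    have h5 : u ≤ Real.exp u / 4 + 4 := by
      have := Real.add_one_le_exp (u - 2)
      have h6 : Real.exp (u - 2) ≤ Real.exp u / 4 := by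
        have h7 : (4 : ℝ) ≤ Real.exp 2 := by
          rw [show (2 : ℝ) = 1 + 1 by norm_num, Real.exp_add]
          nlinarith [Real.add_one_le_exp (1 : ℝ)]
        rw [Real.exp_sub]
        exact div_le_div_of_nonneg_left (Real.exp_pos u).le (by norm_num) h7
      linarith
    nlinarith
  simpa using h1.sub h2

theorem abs_mul_exp_neg_mul_le {c a : ℝ} (hc : 0 ≤ c) (ha : 0 < a) :
    |c * Real.exp (-c * a)| ≤ 1 / a := by
  rw [abs_of_nonneg (by positivity), le_div_iff₀ ha, neg_mul, Real.exp_neg, mul_right_comm,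
    ← div_eq_mul_inv, div_le_one (Real.exp_pos _)]
  linarith [Real.add_one_le_exp (c * a)]

theorem intervalIntegrable_kanterC_mul_exp {ν a : ℝ} (hν0 : 0 < ν) (hν1 : ν < 1) (ha : 0 < a) :
    IntervalIntegrable (fun φ => kanterC ν φ * Real.exp (-(kanterC ν φ) * a)) volume 0 π := by
  rw [intervalIntegrable_iff_integrableOn_Ioo_of_le Real.pi_pos.le]
  refine Measure.integrableOn_of_bounded (M := 1 / a) (by simp) ?_ ?_
  · have : Measurable (kanterC ν) := by
      unfold kanterC
      fun_prop
    exact (show Measurable fun φ => kanterC ν φ * Real.exp (-(kanterC ν φ) * a) by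
      fun_prop).aestronglyMeasurable
  · filter_upwards [ae_restrict_mem measurableSet_Ioo] with φ hφ
    have hA := sin_mul_pos hν0 hν1 hφ
    have hB := sin_mul_pos (sub_pos.2 hν1) (by linarith) hφ
    have hS := Real.sin_pos_of_mem_Ioo hφ
    exact abs_mul_exp_neg_mul_le (by unfold kanterC; positivity) ha

/-- Liemert–Kleine integral representation of `M_ν` on the positive real axis. -/
theorem mainardiM_integral_rep (ν : ℝ) (hν0 : 0 < ν) (hν1 : ν < 1)
    (x : ℝ) (hx : 0 < x)
    (C : ℝ → ℝ)
    (hC : ∀ φ ∈ Set.Ioo (0 : ℝ) π,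
      C φ = (Real.sin ((1 - ν) * φ) / Real.sin φ) *
        (Real.sin (ν * φ) / Real.sin φ) ^ (ν / (1 - ν))) :
    mainardiM ν x = (1 / π) * (x ^ (ν / (1 - ν)) / (1 - ν)) *
      ∫ φ in (0 : ℝ)..π, C φ * Real.exp (-(C φ) * x ^ (1 / (1 - ν))) := by
  obtain ⟨G, hG⟩ := exists_primitive_hankelIntegrand ν x
  have hCK : ∫ φ in (0 : ℝ)..π, C φ * Real.exp (-(C φ) * x ^ (1 / (1 - ν))) =
      ∫ φ in (0 : ℝ)..π, kanterC ν φ * Real.exp (-(kanterC ν φ) * x ^ (1 / (1 - ν))) := by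
    rw [intervalIntegral.integral_of_le Real.pi_pos.le,
      intervalIntegral.integral_of_le Real.pi_pos.le, integral_Ioc_eq_integral_Ioo,
      integral_Ioc_eq_integral_Ioo]
    refine setIntegral_congr_fun measurableSet_Ioo fun φ hφ => ?_
    simp only [hC φ hφ, kanterC]
  have h := intervalIntegral.integral_eq_sub_of_hasDerivAt_of_tendsto Real.pi_pos
    (fun φ hφ => hasDerivAt_im_primitive_curve hν0 hν1 hx hG hφ)
    ((intervalIntegrable_kanterC_mul_exp hν0 hν1 (by positivity)).const_mul _)
    (tendsto_im_primitive_curve_zero hν0 hx hG) (tendsto_im_primitive_curve_pi hν0 hν1 hx hG)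
  rw [intervalIntegral.integral_const_mul, add_sub_cancel_left] at h
  rw [hCK, mul_assoc, h]
  field_simp
end

section
/- Let 0 < ν < 1 and δ > -1. Then ∫_0^∞ x^δ · M_ν(x) dx = Γ(δ+1)/Γ(νδ+1), and in particular (taking δ = 0) ∫_0^∞ M_ν(x) dx = 1. -/
open MeasureTheory Set Filter Asymptotics

/-- If `∂A/∂c = ∂B/∂r` is dominated by an integrable function of `r`, then the change in `c` of the
integral of `A c` over `(0, ∞)` is given by the boundary values of `B` at `r = 0`. -/
theorem integral_Ioi_sub_eq_of_mixed_deriv {A B D : ℝ → ℝ → ℂ} {a b : ℝ} (hab : a ≤ b)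
    {g : ℝ → ℝ} (hg : IntegrableOn g (Ioi 0))
    (hD : ContinuousOn (fun z : ℝ × ℝ => D z.1 z.2) (Icc a b ×ˢ Ioi 0))
    (hDg : ∀ c ∈ Icc a b, ∀ r ∈ Ioi (0 : ℝ), ‖D c r‖ ≤ g r)
    (hA : ∀ c ∈ Icc a b, ∀ r ∈ Ioi (0 : ℝ), HasDerivAt (fun c => A c r) (D c r) c)
    (hB : ∀ c ∈ Ioc a b, ∀ r ∈ Ioi (0 : ℝ), HasDerivAt (B c) (D c r) r)
    (hB0 : ∀ c ∈ Ioc a b, ContinuousWithinAt (B c) (Ici 0) 0)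
    (hBint : ∀ c ∈ Ioc a b, IntegrableOn (B c) (Ioi 0))
    (hAa : IntegrableOn (A a) (Ioi 0)) (hAb : IntegrableOn (A b) (Ioi 0)) :
    (∫ r in Ioi 0, A b r) - ∫ r in Ioi 0, A a r = ∫ c in Ioc a b, -B c 0 := by
  have hint : Integrable (Function.uncurry D)
      ((volume.restrict (Ioc a b)).prod (volume.restrict (Ioi 0))) := by
    refine Integrable.mono' (Integrable.comp_snd hg (volume.restrict (Ioc a b))) ?_ ?_
    · rw [Measure.prod_restrict]
      exact (hD.mono (prod_mono Ioc_subset_Icc_self subset_rfl)).aestronglyMeasurable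
        (measurableSet_Ioc.prod measurableSet_Ioi)
    · rw [Measure.prod_restrict]
      filter_upwards [ae_restrict_mem (measurableSet_Ioc.prod measurableSet_Ioi)] with z hz
      exact hDg _ (Ioc_subset_Icc_self hz.1) _ hz.2
  rw [← integral_sub hAb hAa]
  calc ∫ r in Ioi 0, (A b r - A a r) = ∫ r in Ioi 0, ∫ c in Ioc a b, D c r := by
        refine setIntegral_congr_fun measurableSet_Ioi fun r hr => ?_
        rw [← intervalIntegral.integral_of_le hab]
        refine (intervalIntegral.integral_eq_sub_of_hasDerivAt (f := fun c => A c r) ?_ ?_).symm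
        · rw [uIcc_of_le hab]
          exact fun c hc => hA c hc r hr
        · refine ContinuousOn.intervalIntegrable ?_
          rw [uIcc_of_le hab]
          exact hD.comp (f := fun c => (c, r)) (by fun_prop) fun c hc => ⟨hc, hr⟩
    _ = ∫ c in Ioc a b, ∫ r in Ioi 0, D c r := (integral_integral_swap hint).symm
    _ = ∫ c in Ioc a b, -B c 0 := by
        refine setIntegral_congr_fun measurableSet_Ioc fun c hc => ?_
        have hDint : IntegrableOn (D c) (Ioi 0) := by
          refine Integrable.mono' hg ?_ ?_
          · refine ContinuousOn.aestronglyMeasurable ?_ measurableSet_Ioi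
            exact hD.comp (f := fun r => (c, r)) (by fun_prop)
              fun r hr => ⟨Ioc_subset_Icc_self hc, hr⟩
          · filter_upwards [ae_restrict_mem measurableSet_Ioi] with r hr
            exact hDg c (Ioc_subset_Icc_self hc) r hr
        have := integral_Ioi_of_hasDerivAt_of_tendsto (hB0 c hc) (hB c hc) hDint
          (tendsto_zero_of_hasDerivAt_of_integrableOn_Ioi (hB c hc) hDint (hBint c hc))
        simpa using this

/-- A factor `exp (-b r)` makes powers and stretched exponentials of a function of at most
linear growth integrable. -/
theorem integrableOn_exp_neg_mul_rpow_mul_exp_rpow {g : ℝ → ℝ} {K b : ℝ} (hb : 0 < b)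
    (q x : ℝ) {ν : ℝ} (hν : ν < 1) (hgc : ContinuousOn g (Ici 0)) (hg0 : ∀ r ∈ Ici (0 : ℝ), 0 < g r)
    (hgt : Tendsto g atTop atTop) (hgK : ∀ r ∈ Ici (0 : ℝ), g r ≤ K + r) :
    IntegrableOn (fun r => Real.exp (-b * r) * (g r ^ q * Real.exp (x * g r ^ ν))) (Ioi 0) := by
  refine integrable_of_isBigO_exp_neg (half_pos hb) ?_ ?_
  · have h (s : ℝ) : ContinuousOn (fun r => g r ^ s) (Ici 0) :=
      hgc.rpow_const fun r hr => Or.inl (hg0 r hr).ne'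
    exact (by fun_prop : Continuous fun r : ℝ => Real.exp (-b * r)).continuousOn.mul
      ((h q).mul (((h ν).const_smul x).rexp))
  · have hlog : (fun y : ℝ => q * Real.log y) =o[atTop] fun y => y := by
      simpa using (isLittleO_log_rpow_atTop one_pos).const_mul_left q
    have hpow : (fun y : ℝ => x * y ^ ν) =o[atTop] fun y => y := by
      refine IsLittleO.const_mul_left ?_ x
      refine isLittleO_of_tendsto' ?_ ?_
      · filter_upwards [eventually_gt_atTop 0] with y hy h0
        exact absurd h0 hy.ne'
      · refine (tendsto_rpow_neg_atTop (sub_pos.2 hν)).congr' ?_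
        filter_upwards [eventually_gt_atTop 0] with y hy
        rw [neg_sub, Real.rpow_sub_one hy.ne']
    have hsum := (hlog.add hpow).bound (half_pos hb)
    refine IsBigO.of_bound (Real.exp (b / 2 * K)) ?_
    filter_upwards [hgt.eventually hsum, hgt.eventually (eventually_gt_atTop 0),
      eventually_ge_atTop 0] with r hr hgr hr0
    rw [Real.norm_eq_abs, Real.norm_eq_abs, abs_of_pos hgr] at hr
    rw [Real.norm_of_nonneg (by positivity), Real.norm_of_nonneg (by positivity),
      Real.rpow_def_of_pos hgr q, ← Real.exp_add, ← Real.exp_add, ← Real.exp_add]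
    refine Real.exp_le_exp.2 ?_
    have h1 := (le_abs_self _).trans hr
    have h2 := mul_le_mul_of_nonneg_left (hgK r hr0) (half_pos hb).le
    linarith

/-- The Gamma integral is the same along all rays in the open right half-plane. -/
theorem integral_rpow_mul_cexp_neg_ray_eq {a b p R : ℝ} (ha : -(Real.pi / 2) < a) (hab : a ≤ b)
    (hb : b < Real.pi / 2) (hp : -1 < p) (hR : 0 < R) :
    ∫ r in Ioi (0 : ℝ), Complex.exp (a * (p + 1) * Complex.I) *
        (((r ^ p : ℝ) : ℂ) * Complex.exp (-(r * (R * Complex.exp (a * Complex.I))))) =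
      ∫ r in Ioi (0 : ℝ), Complex.exp (b * (p + 1) * Complex.I) *
        (((r ^ p : ℝ) : ℂ) * Complex.exp (-(r * (R * Complex.exp (b * Complex.I))))) := by
  set A : ℝ → ℝ → ℂ := fun θ r => Complex.exp (θ * (p + 1) * Complex.I) *
    (((r ^ p : ℝ) : ℂ) * Complex.exp (-(r * (R * Complex.exp (θ * Complex.I)))))
  set B : ℝ → ℝ → ℂ := fun θ r => Complex.I * Complex.exp (θ * (p + 1) * Complex.I) *
    (((r ^ (p + 1) : ℝ) : ℂ) * Complex.exp (-(r * (R * Complex.exp (θ * Complex.I))))) with hBdef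
  set D : ℝ → ℝ → ℂ := fun θ r => Complex.I * Complex.exp (θ * (p + 1) * Complex.I) *
    (((p + 1) * ((r ^ p : ℝ) : ℂ) - ((r ^ (p + 1) : ℝ) : ℂ) * (R * Complex.exp (θ * Complex.I))) *
      Complex.exp (-(r * (R * Complex.exp (θ * Complex.I))))) with hDdef
  set β := max |a| |b| with hβ
  have hβ2 : β < Real.pi / 2 :=
    max_lt (abs_lt.2 ⟨ha, hab.trans_lt hb⟩) (abs_lt.2 ⟨ha.trans_le hab, hb⟩)
  have hβ0 : 0 ≤ β := (abs_nonneg a).trans (le_max_left _ _)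
  have hcos : 0 < Real.cos β := Real.cos_pos_of_mem_Ioo ⟨by linarith [Real.pi_pos], hβ2⟩
  have hint (q : ℝ) (hq : -1 < q) : IntegrableOn
      (fun r => r ^ q * Real.exp (-(R * Real.cos β) * r)) (Ioi 0) := by
    simpa using integrableOn_rpow_mul_exp_neg_mul_rpow (p := 1) (s := q) hq one_pos
      (mul_pos hR hcos)
  have hnorm (θ : ℝ) : ‖Complex.exp (θ * (p + 1) * Complex.I)‖ = 1 := by
    have := Complex.norm_exp_ofReal_mul_I (θ * (p + 1))
    push_cast at this
    exact this
  have hexp {θ r : ℝ} (hθ : θ ∈ Icc a b) (hr : 0 < r) :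
      ‖Complex.exp (-(r * (R * Complex.exp (θ * Complex.I))))‖ ≤
        Real.exp (-(R * Real.cos β) * r) := by
    rw [Complex.norm_exp, Complex.neg_re, Complex.re_ofReal_mul, Complex.re_ofReal_mul,
      Complex.exp_ofReal_mul_I_re]
    have h1 : Real.cos β ≤ Real.cos θ := by
      rw [← Real.cos_abs θ]
      refine Real.cos_le_cos_of_nonneg_of_le_pi (abs_nonneg θ) (by linarith [Real.pi_pos]) ?_
      exact (abs_le_max_abs_abs hθ.1 hθ.2)
    refine Real.exp_le_exp.2 ?_
    have h2 := mul_le_mul_of_nonneg_left h1 (mul_pos hr hR).le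
    linarith
  have hcontOn (q : ℝ) : ContinuousOn (fun r : ℝ => ((r ^ q : ℝ) : ℂ)) (Ioi 0) :=
    Complex.continuous_ofReal.comp_continuousOn
      (continuousOn_id.rpow_const fun r hr => Or.inl (ne_of_gt hr))
  have hbase {q : ℝ} (hq : -1 < q) {θ : ℝ} (hθ : θ ∈ Icc a b) : IntegrableOn (fun r : ℝ =>
      ((r ^ q : ℝ) : ℂ) * Complex.exp (-(r * (R * Complex.exp (θ * Complex.I))))) (Ioi 0) := by
    refine Integrable.mono' (hint q hq) ?_ ?_
    · refine ContinuousOn.aestronglyMeasurable ?_ measurableSet_Ioi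
      exact (hcontOn q).mul (Continuous.continuousOn (by fun_prop))
    · filter_upwards [ae_restrict_mem measurableSet_Ioi] with r hr
      rw [norm_mul, Complex.norm_real, Real.norm_of_nonneg (Real.rpow_nonneg (le_of_lt hr) _)]
      exact mul_le_mul_of_nonneg_left (hexp hθ hr) (Real.rpow_nonneg (le_of_lt hr) _)
  have hAint {θ : ℝ} (hθ : θ ∈ Icc a b) : IntegrableOn (A θ) (Ioi 0) := (hbase hp hθ).const_mul _
  have hBcont (θ : ℝ) : Continuous (B θ) := by
    have : Continuous fun r : ℝ => ((r ^ (p + 1) : ℝ) : ℂ) :=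
      Complex.continuous_ofReal.comp (Real.continuous_rpow_const (by linarith))
    fun_prop
  have key := integral_Ioi_sub_eq_of_mixed_deriv (A := A) (B := B) (D := D) hab
    (g := fun r => (p + 1) * (r ^ p * Real.exp (-(R * Real.cos β) * r)) +
      R * (r ^ (p + 1) * Real.exp (-(R * Real.cos β) * r)))
    (((hint p hp).const_mul (p + 1)).add ((hint (p + 1) (by linarith)).const_mul R)) ?_ ?_ ?_ ?_
    (fun θ _ => (hBcont θ).continuousWithinAt)
    (fun θ hθ => (hbase (by linarith) (Ioc_subset_Icc_self hθ)).const_mul _)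
    (hAint ⟨le_rfl, hab⟩) (hAint ⟨hab, le_rfl⟩)
  · have hB0 : ∀ c, B c 0 = 0 := fun c => by
      simp [hBdef, Real.zero_rpow (by linarith : p + 1 ≠ 0)]
    simp only [hB0, neg_zero, integral_zero] at key
    exact (sub_eq_zero.1 key).symm
  · have h (q : ℝ) : ContinuousOn (fun z : ℝ × ℝ => ((z.2 ^ q : ℝ) : ℂ)) (Icc a b ×ˢ Ioi 0) :=
      (hcontOn q).comp continuousOn_snd fun z hz => hz.2
    have h1 := h p
    have h2 := h (p + 1)
    fun_prop
  · intro θ hθ r hr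
    have hr' : 0 < r := hr
    have hp0 : 0 ≤ p + 1 := by linarith
    have hp1 : ‖(p : ℂ) + 1‖ = p + 1 := by
      rw [← Complex.ofReal_one, ← Complex.ofReal_add, Complex.norm_real, Real.norm_of_nonneg hp0]
    simp only [hDdef]
    rw [norm_mul, norm_mul, Complex.norm_I, hnorm, one_mul, one_mul, norm_mul]
    have hfac (y : ℝ) : (p + 1) * (r ^ p * y) + R * (r ^ (p + 1) * y) =
        ((p + 1) * r ^ p + R * r ^ (p + 1)) * y := by ring
    rw [hfac]
    refine mul_le_mul ?_ (hexp hθ hr) (norm_nonneg _) (by positivity)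
    refine (norm_sub_le _ _).trans (le_of_eq ?_)
    rw [norm_mul, norm_mul, norm_mul, hp1, Complex.norm_exp_ofReal_mul_I, Complex.norm_real,
      Complex.norm_real, Complex.norm_real, Real.norm_of_nonneg (by positivity),
      Real.norm_of_nonneg (by positivity), Real.norm_of_nonneg hR.le, mul_one, mul_comm R]
  · intro θ _ r hr
    have hr' : 0 < r := hr
    have h1 : HasDerivAt (fun θ : ℝ => (θ : ℂ)) 1 θ := Complex.ofRealCLM.hasDerivAt
    have h2 := ((h1.mul_const ((p : ℂ) + 1)).mul_const Complex.I).cexp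
    have h3 := ((((h1.mul_const Complex.I).cexp.const_mul (R : ℂ)).const_mul (r : ℂ)).neg.cexp
      ).const_mul ((r ^ p : ℝ) : ℂ)
    convert! h2.mul h3 using 1
    simp only [hDdef, Pi.neg_apply]
    rw [Real.rpow_add_one hr'.ne']
    push_cast
    ring
  · intro θ _ r hr
    have hr' : 0 < r := hr
    have h1 : HasDerivAt (fun r : ℝ => (r : ℂ)) 1 r := Complex.ofRealCLM.hasDerivAt
    have h2 := (Real.hasDerivAt_rpow_const (x := r) (p := p + 1) (Or.inl hr'.ne')).ofReal_comp
    have h3 := (h1.mul_const (R * Complex.exp (θ * Complex.I))).neg.cexp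
    convert! (h2.mul h3).const_mul (Complex.I * Complex.exp (θ * (p + 1) * Complex.I)) using 1
    simp only [hDdef, add_sub_cancel_right, Pi.neg_apply]
    push_cast
    ring

/-- The Laplace transform of a power, for a complex parameter. -/
theorem integral_rpow_mul_cexp_neg_mul {w : ℂ} (hw : 0 < w.re) {p : ℝ} (hp : -1 < p) :
    ∫ r in Ioi (0 : ℝ), ((r ^ p : ℝ) : ℂ) * Complex.exp (-(r * w)) =
      (Real.Gamma (p + 1) : ℝ) * w ^ ((-(p + 1) : ℝ) : ℂ) := by
  have hw0 : w ≠ 0 := fun h => by simp [h] at hw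
  have hR : 0 < ‖w‖ := norm_pos_iff.2 hw0
  have harg := abs_lt.1 (Complex.abs_arg_lt_pi_div_two_iff.2 (Or.inl hw))
  have hpi := Real.pi_pos
  have hrot : ∫ r in Ioi (0 : ℝ), Complex.exp (w.arg * (p + 1) * Complex.I) *
        (((r ^ p : ℝ) : ℂ) * Complex.exp (-(r * (‖w‖ * Complex.exp (w.arg * Complex.I))))) =
      ∫ r in Ioi (0 : ℝ), Complex.exp ((0 : ℝ) * (p + 1) * Complex.I) *
        (((r ^ p : ℝ) : ℂ) * Complex.exp (-(r * (‖w‖ * Complex.exp ((0 : ℝ) * Complex.I))))) := by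
    rcases le_total w.arg 0 with h | h
    · exact integral_rpow_mul_cexp_neg_ray_eq harg.1 h (by linarith) hp hR
    · exact (integral_rpow_mul_cexp_neg_ray_eq (by linarith) h harg.2 hp hR).symm
  rw [Complex.norm_mul_exp_arg_mul_I, integral_const_mul] at hrot
  have hG := Real.integral_rpow_mul_exp_neg_mul_Ioi (a := p + 1) (by linarith) hR
  rw [add_sub_cancel_right] at hG
  have hreal : ∫ r in Ioi (0 : ℝ), Complex.exp ((0 : ℝ) * (p + 1) * Complex.I) *
        (((r ^ p : ℝ) : ℂ) * Complex.exp (-(r * (‖w‖ * Complex.exp ((0 : ℝ) * Complex.I))))) =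
      (((1 / ‖w‖) ^ (p + 1) * Real.Gamma (p + 1) : ℝ) : ℂ) := by
    rw [← hG, ← integral_complex_ofReal]
    refine setIntegral_congr_fun measurableSet_Ioi fun r _ => ?_
    simp [mul_comm]
  rw [hreal] at hrot
  rw [Complex.cpow_def_of_ne_zero hw0, Complex.log, one_div, Real.inv_rpow hR.le,
    ← Real.rpow_neg hR.le, Real.rpow_def_of_pos hR] at *
  refine mul_left_cancel₀ (Complex.exp_ne_zero (w.arg * (p + 1) * Complex.I)) (hrot.trans ?_)
  push_cast
  rw [mul_left_comm, ← Complex.exp_add, mul_comm]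
  ring_nf

/-- The point at distance `r` from `c` in the direction `φ`. -/
noncomputable def rayPoint (φ c r : ℝ) : ℂ := c + r * Complex.exp (φ * Complex.I)

section rayPoint

variable {φ c r : ℝ}

theorem rayPoint_re : (rayPoint φ c r).re = c + r * Real.cos φ := by
  rw [rayPoint, Complex.add_re, Complex.ofReal_re, Complex.re_ofReal_mul,
    Complex.exp_ofReal_mul_I_re]

theorem rayPoint_im : (rayPoint φ c r).im = r * Real.sin φ := by
  rw [rayPoint, Complex.add_im, Complex.ofReal_im, Complex.im_ofReal_mul,
    Complex.exp_ofReal_mul_I_im, zero_add]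

theorem rayPoint_zero_right : rayPoint φ c 0 = c := by simp [rayPoint]

theorem rayPoint_mem_slitPlane (hφ0 : 0 < φ) (hφπ : φ < Real.pi) (hr : 0 ≤ r)
    (h : 0 < r ∨ 0 < c) : rayPoint φ c r ∈ Complex.slitPlane := by
  rw [Complex.mem_slitPlane_iff, rayPoint_re, rayPoint_im]
  rcases hr.eq_or_lt with rfl | hr
  · left
    simpa using h
  · right
    exact (mul_pos hr (Real.sin_pos_of_pos_of_lt_pi hφ0 hφπ)).ne'

theorem norm_rayPoint_le (hc : 0 ≤ c) (hr : 0 ≤ r) : ‖rayPoint φ c r‖ ≤ c + r := by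
  refine (norm_add_le _ _).trans (le_of_eq ?_)
  rw [norm_mul, Complex.norm_exp_ofReal_mul_I, Complex.norm_real, Complex.norm_real,
    Real.norm_of_nonneg hc, Real.norm_of_nonneg hr, mul_one]

theorem rayPoint_mul_exp_neg_im :
    (rayPoint φ c r * Complex.exp ((-φ : ℝ) * Complex.I)).im = -(c * Real.sin φ) := by
  rw [Complex.mul_im, Complex.exp_ofReal_mul_I_re, Complex.exp_ofReal_mul_I_im, rayPoint_re,
    rayPoint_im, Real.sin_neg, Real.cos_neg]
  ring

theorem mul_sin_le_norm_rayPoint : c * Real.sin φ ≤ ‖rayPoint φ c r‖ := by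
  have h := Complex.abs_im_le_norm (rayPoint φ c r * Complex.exp ((-φ : ℝ) * Complex.I))
  rw [rayPoint_mul_exp_neg_im, abs_neg, norm_mul, Complex.norm_exp_ofReal_mul_I, mul_one] at h
  exact (le_abs_self _).trans h

theorem arg_rayPoint_nonneg (hφ0 : 0 < φ) (hφπ : φ < Real.pi) (hr : 0 ≤ r) :
    0 ≤ (rayPoint φ c r).arg := by
  rw [Complex.arg_nonneg_iff, rayPoint_im]
  exact mul_nonneg hr (Real.sin_pos_of_pos_of_lt_pi hφ0 hφπ).le

theorem arg_rayPoint_le (hφ0 : 0 < φ) (hφπ : φ < Real.pi) (hc : 0 < c) :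
    (rayPoint φ c r).arg ≤ φ := by
  by_contra! h
  have hs : 0 < c * Real.sin φ := mul_pos hc (Real.sin_pos_of_pos_of_lt_pi hφ0 hφπ)
  have him := rayPoint_mul_exp_neg_im (φ := φ) (c := c) (r := r)
  rw [← Complex.norm_mul_exp_arg_mul_I (rayPoint φ c r), mul_assoc, ← Complex.exp_add, ← add_mul,
    ← Complex.ofReal_add, Complex.im_ofReal_mul, Complex.exp_ofReal_mul_I_im] at him
  have : 0 ≤ Real.sin ((rayPoint φ c r).arg + -φ) :=
    Real.sin_nonneg_of_nonneg_of_le_pi (by linarith)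
      (by linarith [Complex.arg_le_pi (rayPoint φ c r)])
  have := mul_nonneg (norm_nonneg (rayPoint φ c r)) this
  linarith

theorem continuous_rayPoint (φ c : ℝ) : Continuous (rayPoint φ c) := by
  unfold rayPoint
  fun_prop

theorem hasDerivAt_rayPoint_right :
    HasDerivAt (fun r => rayPoint φ c r) (Complex.exp (φ * Complex.I)) r := by
  have h1 : HasDerivAt (fun r : ℝ => (r : ℂ)) 1 r := Complex.ofRealCLM.hasDerivAt
  simpa [rayPoint] using (h1.mul_const (Complex.exp (φ * Complex.I))).const_add (c : ℂ)

theorem hasDerivAt_rayPoint_left : HasDerivAt (fun c => rayPoint φ c r) 1 c := by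
  have h1 : HasDerivAt (fun r : ℝ => (r : ℂ)) 1 c := Complex.ofRealCLM.hasDerivAt
  exact h1.add_const _

theorem norm_cexp_rayPoint :
    ‖Complex.exp (rayPoint φ c r)‖ = Real.exp c * Real.exp (-(-Real.cos φ) * r) := by
  rw [Complex.norm_exp, rayPoint_re, Real.exp_add]
  ring_nf

theorem integrableOn_norm_cexp_rayPoint (hφ : Real.pi / 2 < φ) (hφπ : φ < Real.pi) (hc : 0 < c)
    (q x : ℝ) {ν : ℝ} (hν : ν < 1) :
    IntegrableOn (fun r => ‖Complex.exp (rayPoint φ c r)‖ *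
      (‖rayPoint φ c r‖ ^ q * Real.exp (x * ‖rayPoint φ c r‖ ^ ν))) (Ioi 0) := by
  have hφ0 : 0 < φ := by linarith [Real.pi_pos]
  have hb : 0 < -Real.cos φ := neg_pos.2 (Real.cos_neg_of_pi_div_two_lt_of_lt hφ
    (by linarith [Real.pi_pos]))
  have hsin := Real.sin_pos_of_pos_of_lt_pi hφ0 hφπ
  have h := integrableOn_exp_neg_mul_rpow_mul_exp_rpow (K := c) hb q x hν
    (g := fun r => ‖rayPoint φ c r‖) (continuous_rayPoint φ c).norm.continuousOn
    (fun r _ => (mul_pos hc hsin).trans_le mul_sin_le_norm_rayPoint) ?_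
    (fun r hr => norm_rayPoint_le hc.le hr)
  · refine (h.const_mul (Real.exp c)).congr (ae_of_all _ fun r => ?_)
    simp only [norm_cexp_rayPoint]
    ring
  · refine tendsto_atTop_mono (fun r => ?_) (tendsto_id.atTop_mul_const hsin)
    have := (le_abs_self _).trans (Complex.abs_im_le_norm (rayPoint φ c r))
    rwa [rayPoint_im] at this

theorem integrableOn_cexp_mul_cpow_rayPoint (hφ : Real.pi / 2 < φ) (hφπ : φ < Real.pi)
    (hc : 0 < c) (q : ℝ) :
    IntegrableOn (fun r => Complex.exp (rayPoint φ c r) * rayPoint φ c r ^ (q : ℂ)) (Ioi 0) := by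
  have hφ0 : 0 < φ := by linarith [Real.pi_pos]
  refine Integrable.mono' (integrableOn_norm_cexp_rayPoint hφ hφπ hc q 0 zero_lt_one) ?_ ?_
  · refine ContinuousOn.aestronglyMeasurable ?_ measurableSet_Ioi
    refine (continuous_rayPoint φ c).cexp.continuousOn.mul ?_
    exact (continuous_rayPoint φ c).continuousOn.cpow_const fun r hr =>
      rayPoint_mem_slitPlane hφ0 hφπ (le_of_lt hr) (Or.inl hr)
  · refine ae_of_all _ fun r => le_of_eq ?_
    simp [Complex.norm_cpow_real]

theorem hasDerivAt_cexp_mul_cpow {z : ℂ} (hz : z ∈ Complex.slitPlane) (q : ℂ) :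
    HasDerivAt (fun z => Complex.exp z * z ^ q)
      (Complex.exp z * z ^ q + q * (Complex.exp z * z ^ (q - 1))) z := by
  convert! (Complex.hasDerivAt_exp z).mul ((hasDerivAt_id z).cpow_const (c := q) hz) using 1
  simp only [id]
  ring

theorem hasDerivAt_cexp_mul_cpow_rayPoint_right (hφ0 : 0 < φ) (hφπ : φ < Real.pi) (hr : 0 < r)
    (q : ℂ) :
    HasDerivAt (fun r => Complex.exp (rayPoint φ c r) * rayPoint φ c r ^ q)
      (Complex.exp (φ * Complex.I) * (Complex.exp (rayPoint φ c r) * rayPoint φ c r ^ q +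
        q * (Complex.exp (rayPoint φ c r) * rayPoint φ c r ^ (q - 1)))) r := by
  rw [mul_comm]
  exact (hasDerivAt_cexp_mul_cpow
    (rayPoint_mem_slitPlane hφ0 hφπ hr.le (Or.inl hr)) q).comp r hasDerivAt_rayPoint_right

theorem continuousWithinAt_cexp_mul_cpow_rayPoint (hc : 0 < c) (q : ℂ) :
    ContinuousWithinAt (fun r => Complex.exp (rayPoint φ c r) * rayPoint φ c r ^ q) (Ici 0) 0 := by
  refine ContinuousAt.continuousWithinAt ?_
  refine (continuous_rayPoint φ c).cexp.continuousAt.mul ?_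
  refine (continuous_rayPoint φ c).continuousAt.cpow continuousAt_const ?_
  rw [rayPoint_zero_right]
  exact Complex.ofReal_mem_slitPlane.2 hc

end rayPoint

/-- The half of Hankel's contour integral for `1 / Γ(s)` that lies in the upper half-plane. -/
noncomputable def hankelIntegral (φ s : ℝ) : ℂ :=
  ∫ r in Ioi (0 : ℝ), Complex.exp (φ * Complex.I) *
    (Complex.exp (rayPoint φ 1 r) * rayPoint φ 1 r ^ ((-s : ℝ) : ℂ))

theorem hankelIntegral_im_eq_mul {φ : ℝ} (hφ : Real.pi / 2 < φ) (hφπ : φ < Real.pi) (s : ℝ) :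
    (hankelIntegral φ s).im = s * (hankelIntegral φ (s + 1)).im := by
  have hφ0 : 0 < φ := by linarith [Real.pi_pos]
  set B : ℝ → ℂ := fun r => Complex.exp (rayPoint φ 1 r) * rayPoint φ 1 r ^ ((-s : ℝ) : ℂ)
  have hi (q : ℝ) := integrableOn_cexp_mul_cpow_rayPoint hφ hφπ one_pos q
  have hcast : ((-s : ℝ) : ℂ) - 1 = ((-(s + 1) : ℝ) : ℂ) := by
    push_cast
    ring
  have hder (r : ℝ) (hr : r ∈ Ioi (0 : ℝ)) := hasDerivAt_cexp_mul_cpow_rayPoint_right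
    (c := 1) hφ0 hφπ hr ((-s : ℝ) : ℂ)
  rw [hcast] at hder
  have hD := ((hi (-s)).add ((hi (-(s + 1))).const_mul ((-s : ℝ) : ℂ))).const_mul
    (Complex.exp (φ * Complex.I))
  have h := integral_Ioi_of_hasDerivAt_of_tendsto
    (continuousWithinAt_cexp_mul_cpow_rayPoint one_pos ((-s : ℝ) : ℂ)) hder hD
    (tendsto_zero_of_hasDerivAt_of_integrableOn_Ioi hder hD (hi (-s)))
  have h2 : ∫ r in Ioi (0 : ℝ), Complex.exp (φ * Complex.I) *
      (Complex.exp (rayPoint φ 1 r) * rayPoint φ 1 r ^ ((-s : ℝ) : ℂ) +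
        ((-s : ℝ) : ℂ) *
          (Complex.exp (rayPoint φ 1 r) * rayPoint φ 1 r ^ ((-(s + 1) : ℝ) : ℂ))) =
      hankelIntegral φ s + ((-s : ℝ) : ℂ) * hankelIntegral φ (s + 1) := by
    rw [hankelIntegral, hankelIntegral, ← integral_const_mul, ← integral_add]
    · refine integral_congr_ae (ae_of_all _ fun r => ?_)
      simp only
      ring
    · exact (hi (-s)).const_mul _
    · exact ((hi (-(s + 1))).const_mul _).const_mul _
  rw [h2, rayPoint_zero_right] at h
  have h3 := congrArg Complex.im h
  rw [Complex.add_im, Complex.im_ofReal_mul, Complex.ofReal_one, Complex.one_cpow, mul_one,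
    zero_sub, Complex.neg_im, ← Complex.ofReal_one, Complex.exp_ofReal_im] at h3
  linarith

theorem continuousOn_uncurry_rayPoint_cpow {φ a : ℝ} (hφ0 : 0 < φ) (hφπ : φ < Real.pi) (q : ℂ) :
    ContinuousOn (fun z : ℝ × ℝ => Complex.exp (rayPoint φ z.1 z.2) * rayPoint φ z.1 z.2 ^ q)
      (Icc 0 a ×ˢ Ioi 0) := by
  have h : Continuous fun z : ℝ × ℝ => rayPoint φ z.1 z.2 := by
    unfold rayPoint
    fun_prop
  exact h.cexp.continuousOn.mul (h.continuousOn.cpow_const fun z hz =>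
    rayPoint_mem_slitPlane hφ0 hφπ (le_of_lt hz.2) (Or.inl hz.2))

theorem hankelIntegral_im_of_lt_neg_one {φ : ℝ} (hφ : Real.pi / 2 < φ) (hφπ : φ < Real.pi) {s : ℝ}
    (hs : s < -1) :
    (hankelIntegral φ s).im = Real.pi / Real.Gamma s := by
  obtain ⟨p, rfl⟩ : ∃ p, s = -p := ⟨-s, (neg_neg s).symm⟩
  have hp : 1 < p := by linarith
  have hφ0 : 0 < φ := by linarith [Real.pi_pos]
  have hb : 0 < -Real.cos φ := neg_pos.2 (Real.cos_neg_of_pi_div_two_lt_of_lt hφ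
    (by linarith [Real.pi_pos]))
  have hlin (q : ℝ) : IntegrableOn (fun r : ℝ => Real.exp (-(-Real.cos φ) * r) * (1 + r) ^ q)
      (Ioi 0) := by
    simpa using integrableOn_exp_neg_mul_rpow_mul_exp_rpow (K := 1) hb q 0 zero_lt_one
      (g := fun r => 1 + r) (by fun_prop) (fun r hr => by linarith [mem_Ici.1 hr])
      (tendsto_atTop_add_const_left _ _ tendsto_id) (fun r _ => le_rfl)
  set u : ℂ := Complex.exp (φ * Complex.I) with hu
  have hcast : (p : ℂ) - 1 = ((p - 1 : ℝ) : ℂ) := by push_cast; ring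
  have hbd {c : ℝ} (hc : c ∈ Icc (0 : ℝ) 1) {r : ℝ} (hr : 0 < r) {q : ℝ} (hq : 0 ≤ q) :
      ‖Complex.exp (rayPoint φ c r) * rayPoint φ c r ^ (q : ℂ)‖ ≤
        Real.exp 1 * (Real.exp (-(-Real.cos φ) * r) * (1 + r) ^ q) := by
    rw [norm_mul, norm_cexp_rayPoint, Complex.norm_cpow_real, mul_assoc]
    have h1 : ‖rayPoint φ c r‖ ≤ 1 + r := (norm_rayPoint_le hc.1 hr.le).trans (by linarith [hc.2])
    have h2 := hc.2
    gcongr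
  have hint {c : ℝ} (hc : c ∈ Icc (0 : ℝ) 1) :
      IntegrableOn (fun r => Complex.exp (rayPoint φ c r) * rayPoint φ c r ^ (p : ℂ)) (Ioi 0) := by
    refine Integrable.mono' ((hlin p).const_mul (Real.exp 1)) ?_ ?_
    · refine ContinuousOn.aestronglyMeasurable ?_ measurableSet_Ioi
      exact (continuousOn_uncurry_rayPoint_cpow (a := 1) hφ0 hφπ p).comp (f := fun r => (c, r))
        (by fun_prop) fun r hr => ⟨hc, hr⟩
    · filter_upwards [ae_restrict_mem measurableSet_Ioi] with r hr
      exact hbd hc hr (by linarith)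
  have key := integral_Ioi_sub_eq_of_mixed_deriv zero_le_one
    (A := fun c r => u * (Complex.exp (rayPoint φ c r) * rayPoint φ c r ^ (p : ℂ)))
    (B := fun c r => Complex.exp (rayPoint φ c r) * rayPoint φ c r ^ (p : ℂ))
    (D := fun c r => u * (Complex.exp (rayPoint φ c r) * rayPoint φ c r ^ (p : ℂ) +
        p * (Complex.exp (rayPoint φ c r) * rayPoint φ c r ^ ((p : ℂ) - 1))))
    (g := fun r => Real.exp 1 * (Real.exp (-(-Real.cos φ) * r) * (1 + r) ^ p) +
      p * (Real.exp 1 * (Real.exp (-(-Real.cos φ) * r) * (1 + r) ^ (p - 1))))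
    (((hlin p).const_mul _).add (((hlin (p - 1)).const_mul _).const_mul p)) ?_ ?_ ?_ ?_
    (fun c hc => continuousWithinAt_cexp_mul_cpow_rayPoint hc.1 p)
    (fun c hc => hint (Ioc_subset_Icc_self hc))
    ((hint ⟨le_rfl, zero_le_one⟩).const_mul u) ((hint ⟨zero_le_one, le_rfl⟩).const_mul u)
  · have h1 : ∫ r in Ioi (0 : ℝ), u * (Complex.exp (rayPoint φ 1 r) * rayPoint φ 1 r ^ (p : ℂ)) =
        hankelIntegral φ (-p) := by
      rw [hankelIntegral, neg_neg]
    have h0 : ∫ r in Ioi (0 : ℝ), u * (Complex.exp (rayPoint φ 0 r) * rayPoint φ 0 r ^ (p : ℂ)) =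
        Complex.exp (Real.pi * (p + 1) * Complex.I) * (Real.Gamma (p + 1) : ℝ) := by
      have hneg : -u = Complex.exp (((φ - Real.pi : ℝ) : ℂ) * Complex.I) := by
        rw [Complex.ofReal_sub, sub_mul, Complex.exp_sub, Complex.exp_pi_mul_I, hu, div_neg,
          div_one]
      have hre : 0 < (-u).re := by
        rw [Complex.neg_re, hu, Complex.exp_ofReal_mul_I_re]
        exact hb
      have hlap := integral_rpow_mul_cexp_neg_mul hre (p := p) (by linarith)
      calc ∫ r in Ioi (0 : ℝ), u * (Complex.exp (rayPoint φ 0 r) * rayPoint φ 0 r ^ (p : ℂ)) =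
          ∫ r in Ioi (0 : ℝ), Complex.exp (φ * (p + 1) * Complex.I) *
            (((r ^ p : ℝ) : ℂ) * Complex.exp (-(r * -u))) := by
            refine setIntegral_congr_fun measurableSet_Ioi fun r hr => ?_
            have hr' : 0 < r := hr
            have hlog : Complex.log (rayPoint φ 0 r) = Real.log r + φ * Complex.I := by
              rw [rayPoint, Complex.ofReal_zero, zero_add, Complex.log_ofReal_mul hr'
                (Complex.exp_ne_zero _), Complex.log_exp] <;> simp <;> linarith
            have hne : rayPoint φ 0 r ≠ 0 :=
              Complex.slitPlane_ne_zero (rayPoint_mem_slitPlane hφ0 hφπ hr'.le (Or.inl hr'))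
            rw [Complex.cpow_def_of_ne_zero hne, hlog, Real.rpow_def_of_pos hr', hu]
            simp only [rayPoint, Complex.ofReal_zero, zero_add]
            push_cast
            rw [← Complex.exp_add, ← Complex.exp_add, ← Complex.exp_add, ← Complex.exp_add]
            ring_nf
        _ = Complex.exp (Real.pi * (p + 1) * Complex.I) * (Real.Gamma (p + 1) : ℝ) := by
            rw [integral_const_mul, hlap, hneg, Complex.cpow_def_of_ne_zero (Complex.exp_ne_zero _),
              Complex.log_exp, mul_left_comm, ← Complex.exp_add, mul_comm]
            · push_cast
              ring_nf
            · rw [Complex.im_ofReal_mul, Complex.I_im]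
              linarith
            · rw [Complex.im_ofReal_mul, Complex.I_im]
              linarith
    have h2 : ∫ c in Ioc (0 : ℝ) 1, -(Complex.exp (rayPoint φ c 0) * rayPoint φ c 0 ^ (p : ℂ)) =
        ((∫ c in Ioc (0 : ℝ) 1, -(Real.exp c * c ^ p) : ℝ) : ℂ) := by
      rw [← integral_complex_ofReal]
      refine setIntegral_congr_fun measurableSet_Ioc fun c hc => ?_
      simp only [rayPoint_zero_right]
      rw [Complex.ofReal_neg, Complex.ofReal_mul, Complex.ofReal_exp,
        Complex.ofReal_cpow hc.1.le]
    rw [h1, h0, h2] at key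
    have him := congrArg Complex.im key
    rw [Complex.ofReal_im, Complex.sub_im, mul_comm, Complex.im_ofReal_mul, sub_eq_zero,
      ← Complex.ofReal_one, ← Complex.ofReal_add, ← Complex.ofReal_mul,
      Complex.exp_ofReal_mul_I_im] at him
    rw [him]
    have hrefl := Real.Gamma_mul_Gamma_one_sub (p + 1)
    rw [show 1 - (p + 1) = -p by ring] at hrefl
    have hG : 0 < Real.Gamma (p + 1) := Real.Gamma_pos_of_pos (by linarith)
    by_cases hsin : Real.sin (Real.pi * (p + 1)) = 0
    · rw [hsin, div_zero] at hrefl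
      rw [(mul_eq_zero.1 hrefl).resolve_left hG.ne', hsin]
      simp
    · have hG' : Real.Gamma (-p) ≠ 0 := fun h0 => by
        rw [h0, mul_zero, eq_comm, div_eq_zero_iff] at hrefl
        exact hrefl.elim Real.pi_ne_zero hsin
      rw [eq_div_iff hsin] at hrefl
      rw [eq_div_iff hG']
      linear_combination hrefl
  · refine continuousOn_const.mul ((continuousOn_uncurry_rayPoint_cpow hφ0 hφπ _).add
      (continuousOn_const.mul (continuousOn_uncurry_rayPoint_cpow hφ0 hφπ _)))
  · intro c hc r hr
    rw [norm_mul, hu, Complex.norm_exp_ofReal_mul_I, one_mul]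
    refine (norm_add_le _ _).trans (add_le_add (hbd hc hr (by linarith)) ?_)
    rw [norm_mul, Complex.norm_real, Real.norm_of_nonneg (by linarith), hcast]
    exact mul_le_mul_of_nonneg_left (hbd hc hr (by linarith)) (by linarith)
  · intro c _ r hr
    have := ((hasDerivAt_cexp_mul_cpow (rayPoint_mem_slitPlane (c := c) hφ0 hφπ (le_of_lt hr)
      (Or.inl hr)) (p : ℂ)).comp c hasDerivAt_rayPoint_left).const_mul u
    rwa [mul_one] at this
  · exact fun c _ r hr => hasDerivAt_cexp_mul_cpow_rayPoint_right hφ0 hφπ hr p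

theorem continuous_hankelIntegral {φ : ℝ} (hφ : Real.pi / 2 < φ) (hφπ : φ < Real.pi) :
    Continuous (hankelIntegral φ) := by
  have hφ0 : 0 < φ := by linarith [Real.pi_pos]
  have hi (q : ℝ) := (integrableOn_cexp_mul_cpow_rayPoint hφ hφπ one_pos q).norm
  have hslit {r : ℝ} (hr : r ∈ Ioi (0 : ℝ)) : rayPoint φ 1 r ∈ Complex.slitPlane :=
    rayPoint_mem_slitPlane hφ0 hφπ (le_of_lt hr) (Or.inl hr)
  refine continuous_iff_continuousAt.2 fun s₀ => ?_
  refine continuousAt_of_dominated (Eventually.of_forall fun s => ?_) ?_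
    ((hi (-(s₀ + 1))).add (hi (-(s₀ - 1)))) ?_
  · exact ((integrableOn_cexp_mul_cpow_rayPoint hφ hφπ one_pos (-s)).const_mul _).1
  · filter_upwards [Icc_mem_nhds (sub_one_lt s₀) (lt_add_one s₀)] with s hs
    filter_upwards [ae_restrict_mem measurableSet_Ioi] with r hr
    have hpos : 0 < ‖rayPoint φ 1 r‖ := norm_pos_iff.2 (Complex.slitPlane_ne_zero (hslit hr))
    rw [norm_mul, Complex.norm_exp_ofReal_mul_I, one_mul, Pi.add_apply, norm_mul, norm_mul,
      norm_mul, Complex.norm_cpow_real, Complex.norm_cpow_real, Complex.norm_cpow_real, ← mul_add]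
    refine mul_le_mul_of_nonneg_left ?_ (norm_nonneg _)
    rcases le_total 1 ‖rayPoint φ 1 r‖ with h | h
    · have h1 := Real.rpow_le_rpow_of_exponent_le h (neg_le_neg hs.1)
      have h2 := Real.rpow_nonneg hpos.le (-(s₀ + 1))
      linarith
    · have h1 := Real.rpow_le_rpow_of_exponent_ge hpos h (neg_le_neg hs.2)
      have h2 := Real.rpow_nonneg hpos.le (-(s₀ - 1))
      linarith
  · filter_upwards [ae_restrict_mem measurableSet_Ioi] with r hr
    refine continuousAt_const.mul (continuousAt_const.mul ?_)
    exact continuousAt_const.cpow (by fun_prop) (hslit hr)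

theorem continuous_inv_Gamma : Continuous fun s : ℝ => (Real.Gamma s)⁻¹ := by
  have h := Complex.continuous_re.comp
    (Complex.differentiable_one_div_Gamma.continuous.comp Complex.continuous_ofReal)
  refine h.congr fun s => ?_
  simp only [Function.comp_apply, Complex.Gamma_ofReal]
  rw [← Complex.ofReal_inv, Complex.ofReal_re]

/-- Hankel's formula for the reciprocal Gamma function. -/
theorem hankelIntegral_im {φ : ℝ} (hφ : Real.pi / 2 < φ) (hφπ : φ < Real.pi) (s : ℝ) :
    (hankelIntegral φ s).im = Real.pi / Real.Gamma s := by
  have hclosed : IsClosed {s : ℝ | (hankelIntegral φ s).im = Real.pi / Real.Gamma s} := by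
    refine isClosed_eq (Complex.continuous_im.comp (continuous_hankelIntegral hφ hφπ)) ?_
    simpa only [div_eq_mul_inv] using continuous_inv_Gamma.const_mul Real.pi
  have hIic {a : ℝ} (h : ∀ s < a, (hankelIntegral φ s).im = Real.pi / Real.Gamma s) :
      ∀ s ≤ a, (hankelIntegral φ s).im = Real.pi / Real.Gamma s := by
    have := hclosed.closure_subset_iff.2 (show Iio a ⊆ _ from h)
    rw [closure_Iio] at this
    exact this
  have hind (n : ℕ) : ∀ s < (n : ℝ) - 1, (hankelIntegral φ s).im = Real.pi / Real.Gamma s := by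
    induction n with
    | zero => exact fun s hs => hankelIntegral_im_of_lt_neg_one hφ hφπ (by simpa using hs)
    | succ n ih =>
      intro s hs
      push_cast at hs
      rcases le_or_gt s ((n : ℝ) - 1) with h | h
      · exact hIic ih s h
      · have hne : s - 1 ≠ 0 := fun h0 => by
          have h1 : (n : ℝ) < 2 := by linarith
          have h2 : (1 : ℝ) < n := by linarith
          norm_cast at h1 h2
          omega
        have h1 := hankelIntegral_im_eq_mul hφ hφπ (s - 1)
        have h2 := Real.Gamma_add_one hne
        rw [ih (s - 1) (by linarith)] at h1
        rw [sub_add_cancel] at h1 h2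
        rw [h2, mul_comm (s - 1), ← div_div, h1, mul_div_cancel_left₀ _ hne]
  obtain ⟨n, hn⟩ := exists_nat_gt (s + 1)
  exact hind n s (by linarith)

/-- The integrand in the Hankel representation of the Mainardi function. -/
noncomputable def mainardiIntegrand (φ ν x r : ℝ) : ℂ :=
  Complex.exp (φ * Complex.I) *
    (Complex.exp (rayPoint φ 1 r) * rayPoint φ 1 r ^ ((ν - 1 : ℝ) : ℂ) *
      Complex.exp (-(x * rayPoint φ 1 r ^ (ν : ℂ))))

theorem mainardiM_eq_integral {φ ν : ℝ} (hφ : Real.pi / 2 < φ) (hφπ : φ < Real.pi)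
    (hν1 : ν < 1) (x : ℝ) :
    mainardiM ν x = (∫ r in Ioi (0 : ℝ), mainardiIntegrand φ ν x r).im / Real.pi := by
  have hφ0 : 0 < φ := by linarith [Real.pi_pos]
  have hslit {r : ℝ} (hr : r ∈ Ioi (0 : ℝ)) : rayPoint φ 1 r ∈ Complex.slitPlane :=
    rayPoint_mem_slitPlane hφ0 hφπ (le_of_lt hr) (Or.inl hr)
  set u : ℂ := Complex.exp (φ * Complex.I) with hu
  have hsum (y : ℝ) : HasSum (fun n : ℕ => y ^ n / n.factorial) (Real.exp y) := by
    rw [Real.exp_eq_exp_ℝ]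
    exact NormedSpace.expSeries_div_hasSum_exp y
  have hsumC (z : ℂ) : HasSum (fun n : ℕ => z ^ n / n.factorial) (Complex.exp z) := by
    rw [Complex.exp_eq_exp_ℂ]
    exact NormedSpace.expSeries_div_hasSum_exp z
  have hterm (n : ℕ) {r : ℝ} (hr : r ∈ Ioi (0 : ℝ)) :
      (((-x) ^ n / n.factorial : ℝ) : ℂ) * (u * (Complex.exp (rayPoint φ 1 r) *
        rayPoint φ 1 r ^ ((-(-ν * n + (1 - ν)) : ℝ) : ℂ))) =
      u * (Complex.exp (rayPoint φ 1 r) * rayPoint φ 1 r ^ ((ν - 1 : ℝ) : ℂ) *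
        ((-(x * rayPoint φ 1 r ^ (ν : ℂ))) ^ n / n.factorial)) := by
    rw [show ((-(-ν * n + (1 - ν)) : ℝ) : ℂ) = ((ν - 1 : ℝ) : ℂ) + (ν : ℂ) * n by push_cast; ring,
      Complex.cpow_add _ _ (Complex.slitPlane_ne_zero (hslit hr)), Complex.cpow_mul_nat,
      ← neg_mul, mul_pow]
    push_cast
    ring
  have key := hasSum_integral_of_dominated_convergence (μ := volume.restrict (Ioi (0 : ℝ)))
    (F := fun (n : ℕ) r => (((-x) ^ n / n.factorial : ℝ) : ℂ) *
      (u * (Complex.exp (rayPoint φ 1 r) * rayPoint φ 1 r ^ ((-(-ν * n + (1 - ν)) : ℝ) : ℂ))))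
    (f := fun r => mainardiIntegrand φ ν x r)
    (fun n r => ‖Complex.exp (rayPoint φ 1 r)‖ * ‖rayPoint φ 1 r‖ ^ (ν - 1) *
      ((|x| * ‖rayPoint φ 1 r‖ ^ ν) ^ n / n.factorial)) ?_ ?_ ?_ ?_ ?_
  · have h := (Complex.hasSum_im key).div_const Real.pi
    rw [← h.tsum_eq, mainardiM, wright]
    refine tsum_congr fun n => ?_
    rw [integral_const_mul, Complex.im_ofReal_mul]
    have := hankelIntegral_im hφ hφπ (-ν * n + (1 - ν))
    rw [hankelIntegral] at this
    rw [this]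
    field_simp
  · intro n
    exact (((integrableOn_cexp_mul_cpow_rayPoint hφ hφπ one_pos _).const_mul u).const_mul _).1
  · intro n
    filter_upwards [ae_restrict_mem measurableSet_Ioi] with r hr
    rw [hterm n hr, norm_mul, hu, Complex.norm_exp_ofReal_mul_I, one_mul, norm_mul, norm_mul,
      norm_div, norm_pow, norm_neg, norm_mul, Complex.norm_real, Complex.norm_cpow_real,
      Complex.norm_cpow_real, Complex.norm_natCast, Real.norm_eq_abs]
  · exact ae_of_all _ fun r => ((hsum _).summable).mul_left _
  · refine (integrableOn_norm_cexp_rayPoint hφ hφπ one_pos (ν - 1) |x| hν1).congr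
      (ae_of_all _ fun r => ?_)
    simp only
    rw [tsum_mul_left, (hsum _).tsum_eq, mul_assoc]
  · filter_upwards [ae_restrict_mem measurableSet_Ioi] with r hr
    refine HasSum.congr_fun ?_ fun n => hterm n hr
    exact ((hsumC _).mul_left _).mul_left _

/-- On a ray in the direction `φ` with `ν φ < π / 2`, the real part of `σ ^ ν` is bounded below by
a positive constant. -/
theorem exists_pos_le_rayPoint_cpow_re {φ ν : ℝ} (hφ0 : 0 < φ) (hφπ : φ < Real.pi) (hν0 : 0 < ν)
    (hνφ : ν * φ < Real.pi / 2) :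
    ∃ κ > 0, ∀ r : ℝ, 0 < r → κ ≤ (rayPoint φ 1 r ^ (ν : ℂ)).re := by
  have hsin := Real.sin_pos_of_pos_of_lt_pi hφ0 hφπ
  have hcos : 0 < Real.cos (ν * φ) :=
    Real.cos_pos_of_mem_Ioo ⟨by linarith [Real.pi_pos, mul_pos hν0 hφ0], hνφ⟩
  refine ⟨Real.sin φ ^ ν * Real.cos (ν * φ), by positivity, fun r hr => ?_⟩
  have hne := Complex.slitPlane_ne_zero
    (rayPoint_mem_slitPlane (c := 1) hφ0 hφπ hr.le (Or.inl hr))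
  have hle := mul_sin_le_norm_rayPoint (φ := φ) (c := 1) (r := r)
  rw [one_mul] at hle
  have harg0 := arg_rayPoint_nonneg (c := 1) hφ0 hφπ hr.le
  have harg := arg_rayPoint_le (r := r) hφ0 hφπ one_pos
  rw [Complex.cpow_def_of_ne_zero hne, Complex.exp_re, Complex.re_mul_ofReal,
    Complex.im_mul_ofReal, Complex.log_re, Complex.log_im,
    ← Real.rpow_def_of_pos (hsin.trans_le hle)]
  refine mul_le_mul (Real.rpow_le_rpow hsin.le hle hν0.le) ?_ hcos.le (by positivity)
  rw [mul_comm _ ν]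
  exact Real.cos_le_cos_of_nonneg_of_le_pi (by positivity) (by linarith [Real.pi_pos])
    (mul_le_mul_of_nonneg_left harg hν0.le)

theorem continuousOn_uncurry_mainardiIntegrand {φ : ℝ} (hφ0 : 0 < φ) (hφπ : φ < Real.pi) (ν : ℝ) :
    ContinuousOn (fun z : ℝ × ℝ => mainardiIntegrand φ ν z.1 z.2) (Ioi 0 ×ˢ Ioi 0) := by
  have hslit : ∀ z ∈ Ioi (0 : ℝ) ×ˢ Ioi (0 : ℝ), rayPoint φ 1 z.2 ∈ Complex.slitPlane :=
    fun z hz => rayPoint_mem_slitPlane hφ0 hφπ (le_of_lt hz.2) (Or.inl hz.2)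
  have h : Continuous fun z : ℝ × ℝ => rayPoint φ 1 z.2 :=
    (continuous_rayPoint φ 1).comp continuous_snd
  have h1 := h.continuousOn.cpow_const (b := ((ν - 1 : ℝ) : ℂ)) hslit
  have h2 := h.continuousOn.cpow_const (b := (ν : ℂ)) hslit
  exact continuousOn_const.mul ((h.cexp.continuousOn.mul h1).mul
    ((Complex.continuous_ofReal.comp continuous_fst).continuousOn.mul h2).neg.cexp)

theorem integrable_rpow_mul_mainardiIntegrand {φ ν δ : ℝ} (hφ : Real.pi / 2 < φ)
    (hφπ : φ < Real.pi) (hν0 : 0 < ν) (hνφ : ν * φ < Real.pi / 2) (hδ : -1 < δ) :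
    Integrable (Function.uncurry fun x r => ((x ^ δ : ℝ) : ℂ) * mainardiIntegrand φ ν x r)
      ((volume.restrict (Ioi 0)).prod (volume.restrict (Ioi 0))) := by
  have hφ0 : 0 < φ := by linarith [Real.pi_pos]
  obtain ⟨κ, hκ, hκle⟩ := exists_pos_le_rayPoint_cpow_re hφ0 hφπ hν0 hνφ
  have hx : IntegrableOn (fun x : ℝ => x ^ δ * Real.exp (-κ * x)) (Ioi 0) := by
    simpa using integrableOn_rpow_mul_exp_neg_mul_rpow (p := 1) hδ one_pos hκ
  have hr := (integrableOn_cexp_mul_cpow_rayPoint hφ hφπ one_pos (ν - 1)).norm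
  refine Integrable.mono' (Integrable.mul_prod hx hr) ?_ ?_
  · rw [Measure.prod_restrict]
    refine ContinuousOn.aestronglyMeasurable ?_ (measurableSet_Ioi.prod measurableSet_Ioi)
    refine ContinuousOn.mul ?_ (continuousOn_uncurry_mainardiIntegrand hφ0 hφπ ν)
    exact Complex.continuous_ofReal.comp_continuousOn
      (continuousOn_fst.rpow_const fun z hz => Or.inl (ne_of_gt hz.1))
  · rw [Measure.prod_restrict]
    filter_upwards [ae_restrict_mem (measurableSet_Ioi.prod measurableSet_Ioi)] with z hz
    obtain ⟨x, r⟩ := z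
    have hx0 : 0 < x := hz.1
    have hexp : ‖Complex.exp (-(x * rayPoint φ 1 r ^ (ν : ℂ)))‖ ≤ Real.exp (-κ * x) := by
      rw [Complex.norm_exp, Complex.neg_re, Complex.re_ofReal_mul]
      refine Real.exp_le_exp.2 ?_
      linarith [mul_le_mul_of_nonneg_left (hκle r hz.2) hx0.le]
    simp only [Function.uncurry_apply_pair, mainardiIntegrand]
    rw [norm_mul, norm_mul, Complex.norm_exp_ofReal_mul_I, one_mul, Complex.norm_real,
      Real.norm_of_nonneg (Real.rpow_nonneg hx0.le δ), norm_mul, mul_assoc,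
      mul_comm (Real.exp _)]
    exact mul_le_mul_of_nonneg_left (mul_le_mul_of_nonneg_left hexp (norm_nonneg _))
      (Real.rpow_nonneg hx0.le δ)

theorem integral_rpow_mul_mainardiIntegrand {φ ν δ : ℝ} (hφ : Real.pi / 2 < φ)
    (hφπ : φ < Real.pi) (hν0 : 0 < ν) (hνφ : ν * φ < Real.pi / 2) (hδ : -1 < δ) {r : ℝ}
    (hr : 0 < r) :
    ∫ x in Ioi (0 : ℝ), ((x ^ δ : ℝ) : ℂ) * mainardiIntegrand φ ν x r =
      (Real.Gamma (δ + 1) : ℝ) * (Complex.exp (φ * Complex.I) *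
        (Complex.exp (rayPoint φ 1 r) * rayPoint φ 1 r ^ ((-(ν * δ + 1) : ℝ) : ℂ))) := by
  have hφ0 : 0 < φ := by linarith [Real.pi_pos]
  obtain ⟨κ, hκ, hκle⟩ := exists_pos_le_rayPoint_cpow_re hφ0 hφπ hν0 hνφ
  have hlap := integral_rpow_mul_cexp_neg_mul (hκ.trans_le (hκle r hr)) hδ
  have hne := Complex.slitPlane_ne_zero
    (rayPoint_mem_slitPlane (c := 1) hφ0 hφπ hr.le (Or.inl hr))
  have him : (Complex.log (rayPoint φ 1 r) * (ν : ℂ)).im = (rayPoint φ 1 r).arg * ν := by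
    rw [Complex.im_mul_ofReal, Complex.log_im]
  have harg0 := mul_nonneg (arg_rayPoint_nonneg (c := 1) hφ0 hφπ hr.le) hν0.le
  have harg := mul_le_mul_of_nonneg_right (arg_rayPoint_le (r := r) hφ0 hφπ one_pos) hν0.le
  rw [← Complex.cpow_mul _ (by linarith [Real.pi_pos]) (by linarith [Real.pi_pos])] at hlap
  have hpull (x : ℝ) : ((x ^ δ : ℝ) : ℂ) * mainardiIntegrand φ ν x r =
      Complex.exp (φ * Complex.I) * (Complex.exp (rayPoint φ 1 r) *
        rayPoint φ 1 r ^ ((ν - 1 : ℝ) : ℂ)) *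
        (((x ^ δ : ℝ) : ℂ) * Complex.exp (-(x * rayPoint φ 1 r ^ (ν : ℂ)))) := by
    rw [mainardiIntegrand]
    ring
  simp only [hpull]
  rw [integral_const_mul, hlap, show ((-(ν * δ + 1) : ℝ) : ℂ) =
    ((ν - 1 : ℝ) : ℂ) + (ν : ℂ) * ((-(δ + 1) : ℝ) : ℂ) by push_cast; ring,
    Complex.cpow_add _ _ hne]
  ring

theorem integral_rpow_mul_mainardiM {ν δ : ℝ} (hν0 : 0 < ν) (hν1 : ν < 1) (hδ : -1 < δ) :
    ∫ x in Ioi (0 : ℝ), x ^ δ * mainardiM ν x =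
      Real.Gamma (δ + 1) / Real.Gamma (ν * δ + 1) := by
  obtain ⟨φ, hφ, hφπ, hνφ⟩ :
      ∃ φ, Real.pi / 2 < φ ∧ φ < Real.pi ∧ ν * φ < Real.pi / 2 := by
    have hpi := Real.pi_pos
    refine ⟨Real.pi / (1 + ν), ?_, ?_, ?_⟩
    · exact div_lt_div_of_pos_left hpi (by linarith) (by linarith)
    · exact div_lt_self hpi (by linarith)
    · rw [← mul_div_assoc, div_lt_div_iff₀ (by linarith) two_pos]
      nlinarith
  have hint := integrable_rpow_mul_mainardiIntegrand hφ hφπ hν0 hνφ hδ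
  calc ∫ x in Ioi (0 : ℝ), x ^ δ * mainardiM ν x
      = ∫ x in Ioi (0 : ℝ),
          (∫ r in Ioi (0 : ℝ), ((x ^ δ : ℝ) : ℂ) * mainardiIntegrand φ ν x r).im / Real.pi := by
        refine setIntegral_congr_fun measurableSet_Ioi fun x _ => ?_
        rw [mainardiM_eq_integral hφ hφπ hν1, integral_const_mul, Complex.im_ofReal_mul,
          mul_div_assoc]
    _ = (∫ x in Ioi (0 : ℝ), ∫ r in Ioi (0 : ℝ),
          ((x ^ δ : ℝ) : ℂ) * mainardiIntegrand φ ν x r).im / Real.pi := by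
        rw [integral_div]
        congr 1
        exact integral_im hint.integral_prod_left
    _ = ((Real.Gamma (δ + 1) : ℝ) * hankelIntegral φ (ν * δ + 1)).im / Real.pi := by
        rw [integral_integral_swap hint, hankelIntegral, ← integral_const_mul]
        congr 2
        exact setIntegral_congr_fun measurableSet_Ioi fun r hr =>
          integral_rpow_mul_mainardiIntegrand hφ hφπ hν0 hνφ hδ hr
    _ = Real.Gamma (δ + 1) / Real.Gamma (ν * δ + 1) := by
        rw [Complex.im_ofReal_mul, hankelIntegral_im hφ hφπ]
        field_simp

theorem mainardiM_moments (ν : ℝ) (hν0 : 0 < ν) (hν1 : ν < 1)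
    (δ : ℝ) (hδ : -1 < δ) :
    (∫ x in Set.Ioi (0 : ℝ), x ^ δ * mainardiM ν x =
      Real.Gamma (δ + 1) / Real.Gamma (ν * δ + 1)) ∧
    ∫ x in Set.Ioi (0 : ℝ), mainardiM ν x = 1 := by
  refine ⟨integral_rpow_mul_mainardiM hν0 hν1 hδ, ?_⟩
  simpa using integral_rpow_mul_mainardiM hν0 hν1 (neg_one_lt_zero (R := ℝ))
end
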